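/- arXiv:1112.5484 — 9 statements merged into one kernel-verified Lean document; each statement's English description precedes it below -/
import Mathlib

section
/- For every positive integer k there exist a positive integer d, a group word w in the free group F_d, and a finite simple group G such that w is not a law in G (i.e., w takes some nontrivial value in G), but not every element of G is a product of k elements of the value set G_w; that is, G ≠ (G_w)^k. -/
/-- The set of values of a word `w ∈ F_d` in a group `G`:
`G_w = { w(g₁,…,g_d)^{±1} : gᵢ ∈ G }`. -/
def wordValues {d : ℕ} (w : FreeGroup (Fin d)) (G : Type*) [Group G] : Set G :=
  {g | ∃ f : Fin d → G, FreeGroup.lift f w = g ∨ FreeGroup.lift f w = g⁻¹}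

theorem prime_aux {F G : Type*} [Group F] [Group G] [IsSimpleGroup G]
    (hG : ¬ ∀ a b : G, a * b = b * a) (φ : F →* G) (hφ : Function.Surjective φ)
    (s : Finset (Subgroup F)) (hn : ∀ N ∈ s, N.Normal) (hs : ∀ N ∈ s, ¬ N ≤ φ.ker) :
    (s.inf id).Normal ∧ (s.inf id).map φ = ⊤ := by
  classical
  have htop : ⁅(⊤ : Subgroup G), (⊤ : Subgroup G)⁆ = (⊤ : Subgroup G) := by
    rcases (Subgroup.commutator_normal (⊤ : Subgroup G) ⊤).eq_bot_or_eq_top with h | h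
    · exfalso
      apply hG
      rw [Subgroup.commutator_eq_bot_iff_le_centralizer] at h
      intro a b
      exact (Subgroup.mem_centralizer_iff.1 (h (Subgroup.mem_top b))) a (Subgroup.mem_top a)
    · exact h
  induction s using Finset.induction_on with
  | empty =>
    refine ⟨by simp only [Finset.inf_empty]; infer_instance, ?_⟩
    simp only [Finset.inf_empty]
    exact Subgroup.map_top_of_surjective φ hφ
  | insert N s hN ih =>
    obtain ⟨h1, h2⟩ := ih (fun N h => hn N (Finset.mem_insert_of_mem h))
      (fun N h => hs N (Finset.mem_insert_of_mem h))
    have hNn := hn N (Finset.mem_insert_self _ _)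
    have hNs := hs N (Finset.mem_insert_self _ _)
    have hNm : N.map φ = ⊤ := by
      rcases (hNn.map φ hφ).eq_bot_or_eq_top with h | h
      · exact absurd ((Subgroup.map_eq_bot_iff N).1 h) hNs
      · exact h
    rw [Finset.inf_insert, id]
    refine ⟨inferInstance, ?_⟩
    rw [eq_top_iff, ← htop]
    conv_lhs => arg 1; rw [← hNm]
    conv_lhs => arg 2; rw [← h2]
    rw [← Subgroup.map_commutator]
    exact Subgroup.map_mono (Subgroup.commutator_le_inf _ _)

theorem word_aux {G : Type} [Group G] [Finite G] [IsSimpleGroup G]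
    (hG : ¬ ∀ a b : G, a * b = b * a) (a : G) :
    ∃ (d : ℕ) (_ : 0 < d) (w : FreeGroup (Fin d)),
      (∃ f : Fin d → G, FreeGroup.lift f w = a) ∧
      ∀ f : Fin d → G, FreeGroup.lift f w = 1 ∨ ∃ α : G ≃* G, FreeGroup.lift f w = α a := by
  classical
  have e : Fin (Nat.card G) ≃ G := (Finite.equivFin G).symm
  refine ⟨Nat.card G, Nat.card_pos, ?_⟩
  set φ : FreeGroup (Fin (Nat.card G)) →* G := FreeGroup.lift e with hφd
  have hφ : Function.Surjective φ := fun g => ⟨FreeGroup.of (e.symm g), by simp [hφd]⟩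
  have hidx : φ.ker.index = Nat.card G := by
    rw [Subgroup.index_ker, MonoidHom.range_eq_top.2 hφ, Subgroup.card_top]
  have key : ∀ ψ : FreeGroup (Fin (Nat.card G)) →* G, ψ.ker ≤ φ.ker →
      ψ.ker = φ.ker ∧ Function.Surjective ψ := by
    intro ψ h
    have h1 := Subgroup.relIndex_mul_index h
    have h2 : ψ.ker.index ≤ Nat.card G := by
      rw [Subgroup.index_ker]
      exact Subgroup.card_le_card_group _
    have h3 : 0 < ψ.ker.index := by
      rw [Subgroup.index_ker]; exact Nat.card_pos
    have hpos : 0 < Nat.card G := Nat.card_pos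
    rw [hidx] at h1
    have h4 : ψ.ker.relIndex φ.ker = 1 := by
      have : ψ.ker.relIndex φ.ker ≠ 0 := by
        intro h0; rw [h0] at h1; omega
      nlinarith [Nat.pos_of_ne_zero this]
    refine ⟨le_antisymm h (Subgroup.relIndex_eq_one.1 h4), ?_⟩
    rw [← MonoidHom.range_eq_top]
    apply Subgroup.eq_top_of_card_eq
    rw [← Subgroup.index_ker, ← h1, h4, one_mul]
  let _ : Fintype (Fin (Nat.card G) → G) := Fintype.ofFinite _
  let s : Finset (Subgroup (FreeGroup (Fin (Nat.card G)))) :=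
    (Finset.univ.image fun f : Fin (Nat.card G) → G => (FreeGroup.lift f).ker).filter (· ≠ φ.ker)
  have hs := prime_aux hG φ hφ s
    (by
      intro N hN
      simp only [s, Finset.mem_filter, Finset.mem_image] at hN
      obtain ⟨⟨f, -, rfl⟩, -⟩ := hN
      infer_instance)
    (by
      intro N hN hle
      simp only [s, Finset.mem_filter, Finset.mem_image] at hN
      obtain ⟨⟨f, -, rfl⟩, h⟩ := hN
      exact h (key _ hle).1)
  have ha : a ∈ (s.inf id).map φ := by rw [hs.2]; trivial
  obtain ⟨w, hw, hwa⟩ := ha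
  refine ⟨w, ⟨e, hwa⟩, fun f => ?_⟩
  by_cases hf : (FreeGroup.lift f).ker = φ.ker
  · right
    have hsur := (key _ hf.le).2
    let β : G →* G := φ.liftOfSurjective hφ ⟨FreeGroup.lift f, hf.ge⟩
    have hβ : ∀ x, β (φ x) = FreeGroup.lift f x := fun x =>
      MonoidHom.liftOfRightInverse_comp_apply _ _ _ _ x
    have hb : Function.Surjective β := by
      intro g
      obtain ⟨x, rfl⟩ := hsur g
      exact ⟨φ x, hβ x⟩
    refine ⟨MulEquiv.ofBijective β (Finite.injective_iff_surjective.2 hb |> fun h => ⟨h, hb⟩), ?_⟩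
    rw [← hwa]
    exact (hβ w).symm
  · left
    have : s.inf id ≤ (FreeGroup.lift f).ker := by
      apply Finset.inf_le (f := id)
      simp only [s, Finset.mem_filter, Finset.mem_image]
      exact ⟨⟨f, Finset.mem_univ _, rfl⟩, hf⟩
    exact this hw

theorem class_card {G : Type*} [Group G] [Finite G] (g : G) :
    {h : G | IsConj g h}.ncard * Nat.card (Subgroup.centralizer {g}) = Nat.card G := by
  classical
  have _ := Fintype.ofFinite G
  rw [Subgroup.nat_card_centralizer_nat_card_stabilizer]
  have h : {h : G | IsConj g h} = MulAction.orbit (ConjAct G) g := by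
    ext x
    rw [ConjAct.mem_orbit_conjAct, Set.mem_ofPred_eq, isConj_comm]
  rw [h, ← Nat.card_coe_set_eq]
  have := MulAction.card_orbit_mul_card_stabilizer_eq_card_group (ConjAct G) g
  simp only [← Nat.card_eq_fintype_card] at this
  exact this

theorem num_aux (k : ℕ) : ∃ n : ℕ, 5 ≤ n ∧ 2 * ((n + 1) * (2 * n ^ 3)) ^ k < n.factorial := by
  have h1 := tendsto_pow_const_div_const_pow_of_one_lt (5 * k) (r := (2:ℝ)) (by norm_num)
  have h2 := FloorSemiring.tendsto_pow_div_factorial_atTop (2 : ℝ)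
  have h3 := h1.eventually_lt_const (u := 1/2) (by norm_num)
  have h4 := h2.eventually_lt_const (u := 1) (by norm_num)
  obtain ⟨n, ⟨h3, h4⟩, h5⟩ := ((h3.and h4).and (Filter.eventually_ge_atTop 5)).exists
  refine ⟨n, h5, ?_⟩
  rw [div_lt_iff₀ (by positivity)] at h3 h4
  have h6 : 2 * n ^ (5 * k) < n.factorial := by
    have : (2 * n ^ (5 * k) : ℝ) < n.factorial := by linarith
    exact_mod_cast this
  refine lt_of_le_of_lt ?_ h6
  rw [pow_mul]
  gcongr
  have : (n+1) * 2 ≤ n ^ 2 := by nlinarith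
  calc (n + 1) * (2 * n ^ 3) = ((n+1) * 2) * n ^ 3 := by ring
    _ ≤ n ^ 2 * n ^ 3 := by gcongr
    _ = n ^ 5 := by ring

theorem list_aux {G : Type*} [Group G] [Finite G] (S : Set G) (k : ℕ)
    (h : ∀ g : G, ∃ l : List G, l.length = k ∧ (∀ x ∈ l, x ∈ S) ∧ l.prod = g) :
    Nat.card G ≤ S.ncard ^ k := by
  have hsur : Function.Surjective (fun v : Fin k → S => (List.ofFn fun i => (v i : G)).prod) := by
    intro g
    obtain ⟨l, rfl, hl, hp⟩ := h g
    refine ⟨fun i => ⟨l.get i, hl _ (List.get_mem _ _)⟩, ?_⟩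
    simp only [List.get_eq_getElem]
    rw [← hp]
    congr 1
    exact List.ofFn_getElem
  have := Nat.card_le_card_of_surjective _ hsur
  rwa [Nat.card_fun, Nat.card_fin, Nat.card_coe_set_eq] at this

theorem cent_aut {G : Type*} [Group G] [Finite G] (a : G) (α : G ≃* G) :
    Nat.card (Subgroup.centralizer {a}) ≤ Nat.card (Subgroup.centralizer {α a}) := by
  refine Nat.card_le_card_of_injective
    (fun x : Subgroup.centralizer {a} => (⟨α x.1, ?_⟩ : Subgroup.centralizer {α a})) ?_
  · have := x.2
    rw [Subgroup.mem_centralizer_singleton_iff] at this ⊢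
    rw [← map_mul, ← map_mul, this]
  · intro x y h
    exact Subtype.ext (α.injective (congrArg Subtype.val h))

theorem cent_inv {G : Type*} [Group G] (a : G) :
    Subgroup.centralizer {a⁻¹} = Subgroup.centralizer {a} := by
  ext x
  rw [Subgroup.mem_centralizer_singleton_iff, Subgroup.mem_centralizer_singleton_iff]
  constructor
  · intro h
    simpa using (Commute.inv_right (show Commute x a⁻¹ from h)).eq
  · intro h
    exact (Commute.inv_right (show Commute x a from h)).eq

/-- The small set containing all word values. -/
def smallSet (n : ℕ) : Set (alternatingGroup (Fin n)) :=
  {x | x ^ 3 = 1 ∧ Nat.card (alternatingGroup (Fin n)) ≤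
    n ^ 3 * Nat.card (Subgroup.centralizer {x})}

theorem smallSet_card (n : ℕ) (hn : 5 ≤ n) : (smallSet n).ncard ≤ (n + 1) * (2 * n ^ 3) := by
  classical
  have : Nontrivial (Fin n) := Fin.nontrivial_iff_two_le.2 (by omega)
  have _ : Fact (Nat.Prime 3) := ⟨Nat.prime_three⟩
  have hsub : smallSet n ⊆ ⋃ m ∈ Finset.range (n + 1),
      {x | x ∈ smallSet n ∧ x.1.cycleType = Multiset.replicate m 3} := by
    intro x hx
    have h3 : x.1 ^ 3 = 1 := by simpa using congrArg Subtype.val hx.1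
    have hc := Equiv.Perm.cycleType_of_pow_prime_eq_one h3
    simp only [Set.mem_iUnion]
    refine ⟨Multiset.card x.1.cycleType, ?_, hx, hc⟩
    have h1 := Equiv.Perm.sum_cycleType_le x.1
    rw [hc, Multiset.sum_replicate, Fintype.card_fin, smul_eq_mul] at h1
    rw [Finset.mem_range]
    omega
  have hone : ∀ m ∈ Finset.range (n + 1),
      {x | x ∈ smallSet n ∧ x.1.cycleType = Multiset.replicate m 3}.ncard ≤ 2 * n ^ 3 := by
    intro m _
    rcases Set.eq_empty_or_nonempty
      {x | x ∈ smallSet n ∧ x.1.cycleType = Multiset.replicate m 3} with h | ⟨x, hx, hxc⟩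
    · rw [h]; simp
    · have h1 : {x | x ∈ smallSet n ∧ x.1.cycleType = Multiset.replicate m 3}.ncard ≤
          {h : Equiv.Perm (Fin n) | IsConj x.1 h}.ncard := by
        refine Set.ncard_le_ncard_of_injOn (fun y => y.1) ?_ Subtype.val_injective.injOn
          (Set.toFinite _)
        intro y hy
        exact Equiv.Perm.isConj_iff_cycleType_eq.2 (hxc.trans hy.2.symm)
      refine h1.trans ?_
      have h2 := class_card x.1
      have h3 : Nat.card (Subgroup.centralizer {x}) ≤ Nat.card (Subgroup.centralizer {x.1}) := by
        refine Nat.card_le_card_of_injective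
          (fun y : Subgroup.centralizer {x} => (⟨y.1.1, ?_⟩ : Subgroup.centralizer {x.1})) ?_
        · have := y.2
          rw [Subgroup.mem_centralizer_singleton_iff] at this ⊢
          exact congrArg Subtype.val this
        · intro y z h
          have h' : y.1.1 = z.1.1 := by injection h
          exact Subtype.ext (Subtype.ext h')
      have h4 := two_mul_nat_card_alternatingGroup (α := Fin n)
      have h5 := hx.2
      have hpos : 0 < Nat.card (Subgroup.centralizer {x.1}) := Nat.card_pos
      refine Nat.le_of_mul_le_mul_right ?_ hpos
      rw [h2, ← h4]
      calc 2 * Nat.card (alternatingGroup (Fin n))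
          ≤ 2 * (n ^ 3 * Nat.card (Subgroup.centralizer {x})) := by gcongr
        _ ≤ 2 * (n ^ 3 * Nat.card (Subgroup.centralizer {x.1})) := by gcongr
        _ = _ := by ring
  calc (smallSet n).ncard ≤ _ := Set.ncard_le_ncard hsub (Set.toFinite _)
    _ ≤ ∑ m ∈ Finset.range (n + 1), _ := Finset.set_ncard_biUnion_le _ _
    _ ≤ ∑ m ∈ Finset.range (n + 1), 2 * n ^ 3 := Finset.sum_le_sum hone
    _ = _ := by simp

theorem threeCycle_mem (n : ℕ) (hn : 5 ≤ n) : ∃ a ∈ smallSet n, a ≠ 1 := by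
  classical
  have hc := Equiv.Perm.card_of_cycleType_singleton (α := Fin n) (n := 3) (by norm_num)
    (by simp; omega)
  rw [Fintype.card_fin] at hc
  have hpos : 0 < Nat.choose n 3 := Nat.choose_pos (by omega)
  have hcard : (Finset.univ.filter fun g : Equiv.Perm (Fin n) => g.cycleType = {3}).card
      ≤ n ^ 3 := by
    rw [hc]
    have h1 := Nat.descFactorial_le_pow n 3
    rw [Nat.descFactorial_eq_factorial_mul_choose] at h1
    simp [Nat.factorial] at h1 ⊢
    omega
  obtain ⟨g, hg⟩ : (Finset.univ.filter fun g : Equiv.Perm (Fin n) => g.cycleType = {3}).Nonempty := by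
    rw [← Finset.card_pos, hc]
    positivity
  have hg3 : g.cycleType = {3} := by simpa using hg
  have hg' : g.IsThreeCycle := hg3
  refine ⟨⟨g, hg'.mem_alternatingGroup⟩, ⟨?_, ?_⟩, ?_⟩
  · apply Subtype.ext
    have := pow_orderOf_eq_one g
    rw [hg'.orderOf] at this
    simpa using this
  · rw [← class_card (⟨g, hg'.mem_alternatingGroup⟩ : alternatingGroup (Fin n))]
    gcongr
    refine le_trans ?_ hcard
    rw [← Set.ncard_coe_finset]
    refine Set.ncard_le_ncard_of_injOn (fun y => y.1) ?_ Subtype.val_injective.injOn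
          (Set.toFinite _)
    intro y hy
    have : IsConj g y.1 := (alternatingGroup (Fin n)).subtype.map_isConj hy
    rw [Equiv.Perm.isConj_iff_cycleType_eq, hg3] at this
    simpa using this.symm
  · intro h
    have : g = 1 := congrArg Subtype.val h
    rw [this] at hg3
    simp at hg3

theorem stmt0 (k : ℕ) (hk : 0 < k) :
    ∃ (d : ℕ) (_ : 0 < d) (w : FreeGroup (Fin d)) (G : Type) (_ : Group G) (_ : Finite G),
      IsSimpleGroup G ∧
      (∃ f : Fin d → G, FreeGroup.lift f w ≠ 1) ∧
      {g : G | ∃ l : List G, l.length = k ∧ (∀ x ∈ l, x ∈ wordValues w G) ∧ l.prod = g}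
        ≠ Set.univ := by
  obtain ⟨n, hn, hlt⟩ := num_aux k
  have : Nontrivial (Fin n) := Fin.nontrivial_iff_two_le.2 (by omega)
  have hsimp : IsSimpleGroup (alternatingGroup (Fin n)) :=
    alternatingGroup.isSimpleGroup (by simpa using hn)
  obtain ⟨a, ha, ha1⟩ := threeCycle_mem n hn
  have hnc : ¬ ∀ a b : alternatingGroup (Fin n), a * b = b * a := by
    intro hcomm
    have hz := alternatingGroup.center_eq_bot (α := Fin n) (by simp; omega)
    have h1 : a ∈ Subgroup.center (alternatingGroup (Fin n)) :=
      Subgroup.mem_center_iff.2 fun g => hcomm g a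
    rw [hz] at h1
    exact ha1 (Subgroup.mem_bot.1 h1)
  obtain ⟨d, hd, w, ⟨f, hf⟩, hw⟩ := word_aux hnc a
  refine ⟨d, hd, w, alternatingGroup (Fin n), inferInstance, inferInstance, hsimp,
    ⟨f, by rw [hf]; exact ha1⟩, ?_⟩
  have hval : wordValues w (alternatingGroup (Fin n)) ⊆ smallSet n := by
    have h1 : ∀ f : Fin d → alternatingGroup (Fin n), FreeGroup.lift f w ∈ smallSet n := by
      intro f
      rcases hw f with h | ⟨α, h⟩
      · rw [h]
        refine ⟨one_pow 3, ?_⟩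
        have h2 : Subgroup.centralizer {(1 : alternatingGroup (Fin n))} = ⊤ := by
          ext x; simp [Subgroup.mem_centralizer_singleton_iff]
        rw [h2, Subgroup.card_top]
        exact Nat.le_mul_of_pos_left _ (by positivity)
      · rw [h]
        refine ⟨by rw [← map_pow, ha.1, map_one], ha.2.trans ?_⟩
        exact Nat.mul_le_mul_left _ (cent_aut a α)
    rintro g ⟨f, h | h⟩
    · rw [← h]; exact h1 f
    · have h2 := h1 f
      rw [h] at h2
      obtain ⟨h3, h4⟩ := h2
      rw [cent_inv] at h4
      refine ⟨?_, h4⟩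
      rwa [inv_pow, inv_eq_one] at h3
  intro huniv
  have hle := list_aux (smallSet n) k (by
    intro g
    have hg : g ∈ (Set.univ : Set (alternatingGroup (Fin n))) := Set.mem_univ g
    rw [← huniv] at hg
    obtain ⟨l, h1, h2, h3⟩ := hg
    exact ⟨l, h1, fun x hx => hval (h2 x hx), h3⟩)
  have h4 := two_mul_nat_card_alternatingGroup (α := Fin n)
  rw [Nat.card_perm, Nat.card_fin] at h4
  have h5 : (smallSet n).ncard ^ k ≤ ((n + 1) * (2 * n ^ 3)) ^ k :=
    Nat.pow_le_pow_left (smallSet_card n hn) k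
  omega
end

section
/- For every natural number n ≥ 7 with n ≠ 13, there exists a group word w(x_1,x_2) in the free group F_2 on two generators such that the set of values Alt(n)_w of w in the alternating group Alt(n) consists exactly of the identity and all 3-cycles. -/
open Equiv Equiv.Perm

theorem aux_prime {F G : Type*} [Group F] [Group G] [IsSimpleGroup G]
    (hG : ∃ g h : G, g * h ≠ h * g) (f : F →* G) (hf : Function.Surjective f)
    (A B : Subgroup F) [hA : A.Normal] [hB : B.Normal] (h : A ⊓ B ≤ f.ker) :
    A ≤ f.ker ∨ B ≤ f.ker := by
  have hAm : (A.map f).Normal := hA.map f hf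
  have hBm : (B.map f).Normal := hB.map f hf
  rcases hAm.eq_bot_or_eq_top with h1 | h1
  · left; exact (Subgroup.map_eq_bot_iff _).1 h1
  rcases hBm.eq_bot_or_eq_top with h2 | h2
  · right; exact (Subgroup.map_eq_bot_iff _).1 h2
  exfalso
  obtain ⟨g, k, hgk⟩ := hG
  obtain ⟨a, ha, rfl⟩ : g ∈ A.map f := h1 ▸ Subgroup.mem_top g
  obtain ⟨b, hb, rfl⟩ : k ∈ B.map f := h2 ▸ Subgroup.mem_top k
  have hmem : a * b * a⁻¹ * b⁻¹ ∈ f.ker := by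
    apply h
    constructor
    · have := A.mul_mem ha (hA.conj_mem _ (A.inv_mem ha) b)
      simpa [mul_assoc] using this
    · exact B.mul_mem (hB.conj_mem _ hb a) (B.inv_mem hb)
  rw [MonoidHom.mem_ker] at hmem
  simp only [map_mul, map_inv] at hmem
  apply hgk
  rw [mul_inv_eq_one, mul_inv_eq_iff_eq_mul] at hmem
  exact hmem

theorem aux_inf {F G ι : Type*} [Group F] [Group G] [IsSimpleGroup G] [DecidableEq ι]
    (hG : ∃ g h : G, g * h ≠ h * g) (f : F →* G) (hf : Function.Surjective f)
    (N : ι → Subgroup F) (hN : ∀ i, (N i).Normal) (s : Finset ι) :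
    (s.inf N).Normal ∧ (s.inf N ≤ f.ker → ∃ i ∈ s, N i ≤ f.ker) := by
  induction s using Finset.induction_on with
  | empty =>
    refine ⟨by simp, fun h => ?_⟩
    exfalso
    obtain ⟨g, k, hgk⟩ := hG
    obtain ⟨a, rfl⟩ := hf g
    have : a ∈ f.ker := h (by simp)
    rw [MonoidHom.mem_ker] at this
    simp [this] at hgk
  | insert i s _ ih =>
    obtain ⟨ih1, ih2⟩ := ih
    have := hN i
    rw [Finset.inf_insert]
    refine ⟨inferInstance, fun h => ?_⟩
    rcases aux_prime hG f hf _ _ h with h | h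
    · exact ⟨i, by simp, h⟩
    · obtain ⟨j, hj, hj'⟩ := ih2 h
      exact ⟨j, by simp [hj], hj'⟩

theorem aux_word {G : Type*} [Group G] [Finite G] [IsSimpleGroup G]
    (hG : ∃ g h : G, g * h ≠ h * g) (p0 : Fin 2 → G)
    (hp0 : Function.Surjective (FreeGroup.lift p0)) (t : G) :
    ∃ w : FreeGroup (Fin 2), FreeGroup.lift p0 w = t ∧
      ∀ p : Fin 2 → G, FreeGroup.lift p w = 1 ∨ ∃ φ : G ≃* G, FreeGroup.lift p w = φ t := by
  classical
  have := Fintype.ofFinite G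
  let N : (Fin 2 → G) → Subgroup (FreeGroup (Fin 2)) := fun p => (FreeGroup.lift p).ker
  let s : Finset (Fin 2 → G) := Finset.univ.filter fun p => ¬ N p ≤ N p0
  obtain ⟨hn, hs⟩ := aux_inf hG (FreeGroup.lift p0) hp0 N (fun p => MonoidHom.normal_ker _) s
  have hnot : ¬ s.inf N ≤ (FreeGroup.lift p0).ker := by
    intro h
    obtain ⟨i, hi, hi'⟩ := hs h
    exact (Finset.mem_filter.1 hi).2 hi'
  have htop : (s.inf N).map (FreeGroup.lift p0) = ⊤ := by
    rcases (hn.map _ hp0).eq_bot_or_eq_top with h1 | h1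
    · exact absurd ((Subgroup.map_eq_bot_iff _).1 h1) hnot
    · exact h1
  obtain ⟨w, hw, rfl⟩ : t ∈ (s.inf N).map (FreeGroup.lift p0) := htop ▸ Subgroup.mem_top t
  refine ⟨w, rfl, fun p => ?_⟩
  by_cases hp : N p ≤ N p0
  · right
    have hidx : (N p).index ≤ Nat.card G := by
      simp only [N]
      rw [Subgroup.index_ker]
      exact Nat.card_le_card_of_injective _ Subtype.val_injective
    have hidx0 : (N p0).index = Nat.card G := by
      simp only [N]
      rw [Subgroup.index_ker, MonoidHom.range_eq_top.2 hp0, Subgroup.card_top]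
    have hmul := Subgroup.relIndex_mul_index hp
    have hpos : 0 < Nat.card G := Nat.card_pos
    have hne : (N p).index ≠ 0 := by
      simp only [N]
      rw [Subgroup.index_ker]
      exact Nat.card_pos.ne'
    have h1 : (N p).relIndex (N p0) = 1 := by
      rw [hidx0] at hmul
      have h0 : (N p).relIndex (N p0) ≠ 0 := by
        intro h0; rw [h0] at hmul; omega
      by_contra hc
      have : 2 ≤ (N p).relIndex (N p0) := by omega
      nlinarith
    have heq : N p0 = N p := le_antisymm (Subgroup.relIndex_eq_one.1 h1) hp
    have hsurj : Function.Surjective (FreeGroup.lift p) := by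
      rw [← MonoidHom.range_eq_top]
      apply Subgroup.eq_top_of_card_eq
      rw [← Subgroup.index_ker]
      rw [h1, one_mul, hidx0] at hmul
      exact hmul.symm
    let e1 := QuotientGroup.quotientKerEquivOfSurjective (FreeGroup.lift p0) hp0
    let e2 := QuotientGroup.quotientKerEquivOfSurjective (FreeGroup.lift p) hsurj
    let e3 := QuotientGroup.quotientMulEquivOfEq heq
    refine ⟨(e1.symm.trans e3).trans e2, ?_⟩
    have : e1.symm (FreeGroup.lift p0 w) = (w : FreeGroup (Fin 2) ⧸ N p0) := by
      rw [MulEquiv.symm_apply_eq]; rfl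
    simp only [MulEquiv.trans_apply, this]
    rfl
  · left
    have : s.inf N ≤ N p := Finset.inf_le (by simp [s, hp])
    exact this hw

theorem aux_even5 {α : Type*} [Fintype α] [DecidableEq α] (x : Perm α) (hs : sign x = 1)
    (hc : x.support.card ≤ 5) : x ^ 2 = 1 ∨ x ^ 3 = 1 ∨ x ^ 5 = 1 := by
  have key : ∀ k, (∀ i ∈ x.cycleType, i ∣ k) → x ^ k = 1 := by
    intro k hk
    rw [← orderOf_dvd_iff_pow_eq_one, ← lcm_cycleType]
    exact Multiset.lcm_dvd.2 hk
  rw [← sum_cycleType] at hc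
  rw [sign_of_cycleType] at hs
  have h2 : ∀ i ∈ x.cycleType, 2 ≤ i := fun i hi => two_le_of_mem_cycleType hi
  generalize x.cycleType = m at *
  have hcard : Multiset.card m • 2 ≤ m.sum := Multiset.card_nsmul_le_sum h2
  have hcard' : Multiset.card m ≤ 2 := by simp at hcard; omega
  have hev : Even (m.sum + Multiset.card m) := by
    by_contra ho
    rw [Nat.not_even_iff_odd] at ho
    rw [ho.neg_one_pow] at hs
    exact absurd hs (by decide)
  interval_cases hm : Multiset.card m
  · rw [Multiset.card_eq_zero] at hm
    subst hm
    left; apply key; simp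
  · obtain ⟨a, rfl⟩ := Multiset.card_eq_one.1 hm
    simp at hc hev h2 key
    have : a = 3 ∨ a = 5 := by
      interval_cases a
      all_goals revert hev; decide
    rcases this with rfl | rfl
    · right; left; exact key 3 dvd_rfl
    · right; right; exact key 5 dvd_rfl
  · obtain ⟨a, b, rfl⟩ := Multiset.card_eq_two.1 hm
    simp at hc hev h2 key
    have : a = 2 ∧ b = 2 := by
      obtain ⟨r, hr⟩ := hev
      omega
    obtain ⟨rfl, rfl⟩ := this
    left; exact key 2 dvd_rfl dvd_rfl

theorem aux_three_mul {α : Type*} [Fintype α] [DecidableEq α] (c d : Perm α)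
    (hc : c.IsThreeCycle) (hd : d.IsThreeCycle) :
    (c * d) ^ 2 = 1 ∨ (c * d) ^ 3 = 1 ∨ (c * d) ^ 5 = 1 := by
  by_cases hdis : Disjoint c.support d.support
  · right; left
    have hcomm : Commute c d := (disjoint_iff_disjoint_support.2 hdis).commute
    rw [hcomm.mul_pow]
    have h1 := pow_orderOf_eq_one c
    have h2 := pow_orderOf_eq_one d
    rw [hc.orderOf] at h1
    rw [hd.orderOf] at h2
    simp [h1, h2]
  · apply aux_even5
    · simp [hc.sign, hd.sign]
    · have h1 : (c * d).support ⊆ c.support ∪ d.support := support_mul_le c d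
      have h2 := Finset.card_le_card h1
      have h3 := Finset.card_union_add_card_inter c.support d.support
      rw [hc.card_support, hd.card_support] at h3
      have h4 : 0 < (c.support ∩ d.support).card := by
        rw [Finset.card_pos, ← Finset.not_disjoint_iff_nonempty_inter]
        exact hdis
      omega

theorem aux_bad {α : Type*} [Fintype α] [DecidableEq α] (h7 : 7 ≤ Fintype.card α)
    (σ : Perm α) (h3 : σ ^ 3 = 1) (h1 : σ ≠ 1) (hn : ¬ σ.IsThreeCycle) :
    ∃ g : Perm α, sign g = 1 ∧ (σ * (g * σ * g⁻¹)) ^ 2 ≠ 1 ∧ (σ * (g * σ * g⁻¹)) ^ 3 ≠ 1 ∧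
      (σ * (g * σ * g⁻¹)) ^ 5 ≠ 1 := by
  have hσ3 : ∀ x, σ (σ (σ x)) = x := fun x => by
    have := congrArg (fun p : Perm α => p x) h3
    simpa [pow_succ] using this
  have hfix2 : ∀ x, σ x ≠ x → σ (σ x) ≠ x := by
    intro x hx h
    have := hσ3 x
    rw [h] at this
    exact hx this
  obtain ⟨a, ha⟩ : ∃ a, σ a ≠ a := by
    by_contra! h
    exact h1 (Equiv.ext h)
  obtain ⟨b, hb⟩ : ∃ b, b = σ a := ⟨_, rfl⟩
  obtain ⟨c, hc⟩ : ∃ c, c = σ b := ⟨_, rfl⟩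
  have hca : σ c = a := by rw [hc, hb, hσ3]
  have hab : a ≠ b := by rw [hb]; exact ha.symm
  have hac : a ≠ c := by rw [hc, hb]; exact (hfix2 a ha).symm
  have hbc : b ≠ c := by rw [hc]; intro h; exact hab (by rw [hb] at h; exact (σ.injective h).trans hb.symm)
  obtain ⟨d, hda, hdb, hdc, hd⟩ : ∃ d, d ≠ a ∧ d ≠ b ∧ d ≠ c ∧ σ d ≠ d := by
    by_contra! h
    apply hn
    rw [← card_support_eq_three_iff]
    have : σ.support = {a, b, c} := by
      ext x
      simp only [mem_support, Finset.mem_insert, Finset.mem_singleton]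
      constructor
      · intro hx
        by_contra! hx'
        exact hx (h x hx'.1 hx'.2.1 hx'.2.2)
      · rintro (rfl | rfl | rfl)
        · exact ha
        · rw [← hc]; exact hbc.symm
        · rw [hca]; exact hac
    rw [this]
    exact Finset.card_eq_three.2 ⟨a, b, c, hab, hac, hbc, rfl⟩
  have key : ∀ d, d ≠ a → d ≠ b → d ≠ c → σ d ≠ a ∧ σ d ≠ b ∧ σ d ≠ c := by
    intro d hda hdb hdc
    refine ⟨fun h => hdc (σ.injective (h.trans hca.symm)), fun h => hda (σ.injective (h.trans hb)),
      fun h => hdb (σ.injective (h.trans hc))⟩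
  obtain ⟨e, he⟩ : ∃ e, e = σ d := ⟨_, rfl⟩
  obtain ⟨f, hf⟩ : ∃ f, f = σ e := ⟨_, rfl⟩
  have hfd : σ f = d := by rw [hf, he, hσ3]
  have hde : d ≠ e := by rw [he]; exact hd.symm
  have hdf : d ≠ f := by rw [hf, he]; exact (hfix2 d hd).symm
  have hef : e ≠ f := by rw [hf]; intro h; exact hde (by rw [he] at h; exact (σ.injective h).trans he.symm)
  obtain ⟨hea, heb, hec⟩ := he ▸ key d hda hdb hdc
  obtain ⟨hfa, hfb, hfc⟩ := hf ▸ key e hea heb hec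
  have hsg : ∀ p q r : α, p ≠ q → q ≠ r → sign (swap p q * swap q r) = 1 := by
    intro p q r h h'
    simp [sign_swap h, sign_swap h']
  have hconj : ∀ g : Perm α, ∀ p, (σ * (g * σ * g⁻¹)) (g p) = σ (g (σ p)) := by
    intro g p; simp
  by_cases hz : ∃ z, z ≠ a ∧ z ≠ b ∧ z ≠ c ∧ z ≠ d ∧ z ≠ e ∧ z ≠ f ∧ σ z ≠ z
  · obtain ⟨z, hza, hzb, hzc, hzd, hze, hzf, hz⟩ := hz
    obtain ⟨g, hg⟩ : ∃ g, g = swap a b * swap b d := ⟨_, rfl⟩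
    have hga : g a = b := by
      simp [hg, swap_apply_of_ne_of_ne hab hda.symm]
    have hgb : g b = d := by
      simp [hg, swap_apply_of_ne_of_ne hda hdb]
    have hgd : g d = a := by simp [hg]
    have hgo : ∀ y, y ≠ a → y ≠ b → y ≠ d → g y = y := by
      intro y h1 h2 h3
      simp [hg, swap_apply_of_ne_of_ne, h1, h2, h3]
    refine ⟨g, hg ▸ hsg _ _ _ hab hdb.symm, ?_⟩
    have hx := hconj g
    generalize σ * (g * σ * g⁻¹) = x at hx
    have hgc := hgo c hac.symm hbc.symm hdc.symm
    have hge := hgo e hea heb hde.symm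
    have hgf := hgo f hfa hfb hdf.symm
    have x0 : x a = f := by rw [← hgd, hx, ← he, hge, hf]
    have x1 : x f = b := by rw [← hgf, hx, hfd, hgd, hb]
    have x2 : x b = e := by rw [← hga, hx, ← hb, hgb, he]
    have hoz : ∀ y, y ≠ a → y ≠ b → y ≠ c → y ≠ d → y ≠ e → y ≠ f →
        x y = σ (σ y) := by
      intro y ya yb yc yd ye yf
      obtain ⟨u1, u2, u3⟩ := key y ya yb yc
      have u4 : σ y ≠ d := fun h => yf (σ.injective (h.trans hfd.symm))
      rw [← hgo y ya yb yd, hx, hgo _ u1 u2 u4, hgo y ya yb yd]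
    have hclosed : ∀ y, (y ≠ a ∧ y ≠ b ∧ y ≠ c ∧ y ≠ d ∧ y ≠ e ∧ y ≠ f) →
        (σ y ≠ a ∧ σ y ≠ b ∧ σ y ≠ c ∧ σ y ≠ d ∧ σ y ≠ e ∧ σ y ≠ f) := by
      rintro y ⟨ya, yb, yc, yd, ye, yf⟩
      obtain ⟨u1, u2, u3⟩ := key y ya yb yc
      exact ⟨u1, u2, u3, fun h => yf (σ.injective (h.trans hfd.symm)),
        fun h => yd (σ.injective (h.trans he)), fun h => ye (σ.injective (h.trans hf))⟩
    have c0 : z ≠ a ∧ z ≠ b ∧ z ≠ c ∧ z ≠ d ∧ z ≠ e ∧ z ≠ f := ⟨hza, hzb, hzc, hzd, hze, hzf⟩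
    have c1 := hclosed _ c0
    have c2 := hclosed _ c1
    have z0 : x z = σ (σ z) := by obtain ⟨a1, a2, a3, a4, a5, a6⟩ := c0; exact hoz _ a1 a2 a3 a4 a5 a6
    have z1 : x (σ z) = z := by
      obtain ⟨a1, a2, a3, a4, a5, a6⟩ := c1
      rw [hoz _ a1 a2 a3 a4 a5 a6, hσ3]
    have z2 : x (σ (σ z)) = σ z := by
      obtain ⟨a1, a2, a3, a4, a5, a6⟩ := c2
      rw [hoz _ a1 a2 a3 a4 a5 a6, hσ3]
    refine ⟨fun h => ?_, fun h => ?_, fun h => ?_⟩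
    · have := congrArg (fun p : Perm α => p z) h
      simp [pow_succ, z0, z1, z2] at this
      exact hz this
    · have := congrArg (fun p : Perm α => p a) h
      simp [pow_succ, x0, x1, x2] at this
      exact hea this
    · have := congrArg (fun p : Perm α => p z) h
      simp [pow_succ, z0, z1, z2] at this
      exact hz this
  · obtain ⟨z, hz'⟩ : ∃ z, z ∉ ({a, b, c, d, e, f} : Finset α) := by
      by_contra! h
      have h6 : ({a, b, c, d, e, f} : Finset α).card ≤ 6 := Finset.card_le_six
      rw [Finset.eq_univ_of_forall h, Finset.card_univ] at h6
      omega
    simp only [Finset.mem_insert, Finset.mem_singleton, not_or] at hz'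
    obtain ⟨hza, hzb, hzc, hzd, hze, hzf⟩ := hz'
    have hzz : σ z = z := by
      by_contra h
      exact hz ⟨z, hza, hzb, hzc, hzd, hze, hzf, h⟩
    obtain ⟨g, hg⟩ : ∃ g, g = swap a d * swap d z := ⟨_, rfl⟩
    have hga : g a = d := by
      simp [hg, swap_apply_of_ne_of_ne hda.symm (Ne.symm hza)]
    have hgd : g d = z := by
      simp [hg, swap_apply_of_ne_of_ne hza hzd]
    have hgz : g z = a := by simp [hg]
    have hgo : ∀ y, y ≠ a → y ≠ d → y ≠ z → g y = y := by
      intro y h1 h2 h3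
      simp [hg, swap_apply_of_ne_of_ne, h1, h2, h3]
    refine ⟨g, hg ▸ hsg _ _ _ hda.symm (Ne.symm hzd), ?_⟩
    have hx := hconj g
    generalize σ * (g * σ * g⁻¹) = x at hx
    have hgb := hgo b hab.symm hdb.symm (Ne.symm hzb)
    have hgc := hgo c hac.symm hdc.symm (Ne.symm hzc)
    have hge := hgo e hea hde.symm (Ne.symm hze)
    have hgf := hgo f hfa hdf.symm (Ne.symm hzf)
    have x0 : x a = b := by rw [← hgz, hx, hzz, hgz, hb]
    have x1 : x b = a := by rw [← hgb, hx, ← hc, hgc, hca]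
    have x2 : x c = e := by rw [← hgc, hx, hca, hga, he]
    have x3 : x e = d := by rw [← hge, hx, ← hf, hgf, hfd]
    refine ⟨fun h => ?_, fun h => ?_, fun h => ?_⟩
    · have := congrArg (fun p : Perm α => p c) h
      simp [pow_succ, x2, x3] at this
      exact hdc this
    · have := congrArg (fun p : Perm α => p a) h
      simp [pow_succ, x0, x1] at this
      exact hab this.symm
    · have := congrArg (fun p : Perm α => p a) h
      simp [pow_succ, x0, x1] at this
      exact hab this.symm

theorem aux_aut {α : Type*} [Fintype α] [DecidableEq α] (h7 : 7 ≤ Fintype.card α)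
    (φ : alternatingGroup α ≃* alternatingGroup α) (t : alternatingGroup α)
    (ht : (t : Perm α).IsThreeCycle) : (φ t : Perm α).IsThreeCycle := by
  by_contra hn
  have ht3 : t ^ 3 = 1 := by
    apply Subtype.ext
    have := pow_orderOf_eq_one (t : Perm α)
    rw [ht.orderOf] at this
    simpa using this
  have ht1 : t ≠ 1 := by
    rintro rfl
    exact ht.ne_one rfl
  have h3 : (φ t : Perm α) ^ 3 = 1 := by
    have : φ t ^ 3 = 1 := by rw [← map_pow, ht3, map_one]
    simpa using congrArg Subtype.val this
  have h1 : (φ t : Perm α) ≠ 1 := by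
    intro h
    have : φ t = 1 := Subtype.ext h
    exact ht1 (by simpa using this)
  obtain ⟨g, hg, g2, g3, g5⟩ := aux_bad h7 _ h3 h1 hn
  obtain ⟨h, hh⟩ := φ.surjective ⟨g, mem_alternatingGroup.2 hg⟩
  have hh' : (φ h : Perm α) = g := by rw [hh]
  have hconj : ((h * t * h⁻¹ : alternatingGroup α) : Perm α).IsThreeCycle := by
    unfold IsThreeCycle
    simp only [Subgroup.coe_mul, Subgroup.coe_inv, cycleType_conj]
    exact ht
  have hk : ∀ k : ℕ, ((t : Perm α) * ((h * t * h⁻¹ : alternatingGroup α) : Perm α)) ^ k = 1 →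
      ((φ t : Perm α) * (g * φ t * g⁻¹)) ^ k = 1 := by
    intro k hk
    have : (t * (h * t * h⁻¹)) ^ k = 1 := by
      apply Subtype.ext
      simpa using hk
    have := congrArg φ this
    have := congrArg Subtype.val this
    simpa [hh'] using this
  rcases aux_three_mul _ _ ht hconj with h | h | h
  · exact g2 (hk _ h)
  · exact g3 (hk _ h)
  · exact g5 (hk _ h)

open MulAction Pointwise in
theorem aux_gen {α : Type*} [Fintype α] [DecidableEq α] (a b : Perm α) (e0 e1 e2 e3 : α)
    (h3 : a.IsThreeCycle) (a0 : a e0 = e2) (a2 : a e2 = e1) (a1 : a e1 = e0) (a3 : a e3 = e3)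
    (s : Finset α) (hb : b.IsCycleOn s) (hbs : b.support ⊆ s)
    (m0 : e0 ∉ s) (m2 : e2 ∈ s) (m3 : e3 ∈ s) (hall : ∀ x, x ≠ e0 → x ≠ e1 → x ∈ s) :
    alternatingGroup α ≤ Subgroup.closure {a, b} := by
  obtain ⟨H, hH⟩ : ∃ H, H = Subgroup.closure {a, b} := ⟨_, rfl⟩
  rw [← hH]
  have haH : a ∈ H := hH ▸ Subgroup.subset_closure (by simp)
  have hbH : b ∈ H := hH ▸ Subgroup.subset_closure (by simp)
  have hb0 : b e0 = e0 := by
    by_contra h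
    exact m0 (hbs (mem_support.2 h))
  have hreach : ∀ x, ∃ h : H, h • e2 = x := by
    intro x
    by_cases hx0 : x = e0
    · exact ⟨⟨a * a, H.mul_mem haH haH⟩, by simp [Subgroup.smul_def, a2, a1, hx0]⟩
    by_cases hx1 : x = e1
    · exact ⟨⟨a, haH⟩, by simp [Subgroup.smul_def, a2, hx1]⟩
    obtain ⟨i, hi⟩ := hb.2 m2 (hall x hx0 hx1)
    exact ⟨⟨b ^ i, H.zpow_mem hbH i⟩, by simpa [Subgroup.smul_def] using hi⟩
  have : IsPretransitive H α := by
    constructor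
    intro x y
    obtain ⟨g, rfl⟩ := hreach x
    obtain ⟨h, rfl⟩ := hreach y
    exact ⟨h * g⁻¹, by simp [mul_smul]⟩
  apply alternatingGroup_le_of_isPreprimitive_of_isThreeCycle_mem _ h3 haH
  apply IsPreprimitive.of_isTrivialBlock_base e0
  intro B h0 hB
  have hblk : ∀ g ∈ H, ∀ y ∈ B, g y ∈ B → ∀ z ∈ B, g z ∈ B := by
    intro g hg y hy hgy z hz
    have := hB.smul_eq_of_mem (g := ⟨g, hg⟩) hy hgy
    rw [← this]
    exact ⟨z, hz, rfl⟩
  have hnots : ∀ y ∈ B, y ∈ s → B = Set.univ := by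
    intro y hy hys
    have hsB : ∀ z ∈ s, z ∈ B := by
      intro z hz
      obtain ⟨i, hi⟩ := hb.2 hys hz
      rw [← hi]
      refine hblk _ (H.zpow_mem hbH i) e0 h0 ?_ y hy
      rw [zpow_apply_eq_self_of_apply_eq_self hb0]
      exact h0
    apply Set.eq_univ_of_forall
    intro z
    by_cases hz0 : z = e0
    · rwa [hz0]
    by_cases hz1 : z = e1
    · rw [hz1, ← a2]
      exact hblk a haH e3 (hsB _ m3) (by rw [a3]; exact hsB _ m3) _ (hsB _ m2)
    · exact hsB z (hall z hz0 hz1)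
  by_cases hex : ∃ y ∈ B, y ∈ s
  · obtain ⟨y, hy, hys⟩ := hex
    right; exact hnots y hy hys
  push Not at hex
  left
  have h1B : e1 ∉ B := by
    intro h1
    apply hex e2 _ m2
    rw [← a0]
    exact hblk a haH e1 h1 (by rw [a1]; exact h0) _ h0
  have : ∀ y ∈ B, y = e0 := by
    intro y hy
    by_contra hne
    exact hex y hy (hall y hne (by rintro rfl; exact h1B hy))
  intro y hy z hz
  rw [this y hy, this z hz]

theorem aux_two_gen (n : ℕ) (hn : 7 ≤ n) : ∃ p : Fin 2 → alternatingGroup (Fin n),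
    Function.Surjective (FreeGroup.lift p) ∧ ((p 0 : Perm (Fin n)).IsThreeCycle) := by
  obtain ⟨e0, he0⟩ : ∃ e : Fin n, e.val = 0 := ⟨⟨0, by omega⟩, rfl⟩
  obtain ⟨e1, he1⟩ : ∃ e : Fin n, e.val = 1 := ⟨⟨1, by omega⟩, rfl⟩
  obtain ⟨e2, he2⟩ : ∃ e : Fin n, e.val = 2 := ⟨⟨2, by omega⟩, rfl⟩
  obtain ⟨e3, he3⟩ : ∃ e : Fin n, e.val = 3 := ⟨⟨3, by omega⟩, rfl⟩
  have h01 : e0 ≠ e1 := by intro h; rw [h] at he0; omega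
  have h02 : e0 ≠ e2 := by intro h; rw [h] at he0; omega
  have h03 : e0 ≠ e3 := by intro h; rw [h] at he0; omega
  have h12 : e1 ≠ e2 := by intro h; rw [h] at he1; omega
  have h13 : e1 ≠ e3 := by intro h; rw [h] at he1; omega
  have h23 : e2 ≠ e3 := by intro h; rw [h] at he2; omega
  obtain ⟨s, hsodd, m0, m2, m3, hall⟩ : ∃ s : Finset (Fin n), Odd s.card ∧ e0 ∉ s ∧ e2 ∈ s ∧
      e3 ∈ s ∧ ∀ x, x ≠ e0 → x ≠ e1 → x ∈ s := by
    rcases Nat.even_or_odd n with hev | hodd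
    · refine ⟨{e0}ᶜ, ?_, by simp, by simp [h02.symm], by simp [h03.symm], ?_⟩
      · rw [Finset.card_compl, Finset.card_singleton, Fintype.card_fin]
        exact Nat.Even.sub_odd (by omega) hev odd_one
      · intro x hx _; simp [hx]
    · refine ⟨{e0, e1}ᶜ, ?_, by simp, by simp [h02.symm, h12.symm], by simp [h03.symm, h13.symm], ?_⟩
      · rw [Finset.card_compl, Finset.card_pair h01, Fintype.card_fin]
        exact Nat.Odd.sub_even (by omega) hodd even_two
      · intro x hx hx'; simp [hx, hx']
  obtain ⟨b, hb, hbs⟩ := s.exists_cycleOn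
  have hsnt : (s : Set (Fin n)).Nontrivial := ⟨e2, m2, e3, m3, h23⟩
  have hbsupp : b.support = s := by
    apply le_antisymm hbs
    intro x hx
    exact mem_support.2 (hb.apply_ne hsnt hx)
  have hcyc : b.IsCycle := by
    rw [isCycle_iff_exists_isCycleOn]
    refine ⟨s, hsnt, hb, ?_⟩
    intro x hx
    exact hbs (mem_support.2 hx)
  have hbsign : sign b = 1 := by
    rw [hcyc.sign, hbsupp, hsodd.neg_one_pow, neg_neg]
  let a : Perm (Fin n) := swap e0 e1 * swap e0 e2
  have ha3 : a.IsThreeCycle := isThreeCycle_swap_mul_swap_same h01 h02 h12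
  have hle := aux_gen a b e0 e1 e2 e3 ha3
    (by simp [a, swap_apply_of_ne_of_ne h02.symm h12.symm]) (by simp [a])
    (by simp [a, swap_apply_of_ne_of_ne h01.symm h12])
    (by simp [a, swap_apply_of_ne_of_ne, h03.symm, h13.symm, h23.symm]) s hb hbs m0 m2 m3 hall
  let A : alternatingGroup (Fin n) := ⟨a, ha3.mem_alternatingGroup⟩
  let B : alternatingGroup (Fin n) := ⟨b, mem_alternatingGroup.2 hbsign⟩
  refine ⟨![A, B], ?_, ha3⟩
  have hle2 : Subgroup.closure {a, b} ≤
      (FreeGroup.lift ![A, B]).range.map (alternatingGroup (Fin n)).subtype := by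
    rw [Subgroup.closure_le]
    rintro x (rfl | rfl)
    · exact ⟨A, ⟨FreeGroup.of 0, by simp⟩, rfl⟩
    · exact ⟨B, ⟨FreeGroup.of 1, by simp⟩, rfl⟩
  intro x
  obtain ⟨y, ⟨v, hv⟩, hy⟩ := hle2 (hle x.2)
  exact ⟨v, hv.trans (Subtype.ext hy)⟩

theorem stmt1 (n : ℕ) (hn : 7 ≤ n) (h13 : n ≠ 13) :
    ∃ w : FreeGroup (Fin 2),
      wordValues w (alternatingGroup (Fin n)) =
        {g : alternatingGroup (Fin n) | g = 1 ∨ (g : Equiv.Perm (Fin n)).IsThreeCycle} := by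
  obtain ⟨p0, hp0, ht⟩ := aux_two_gen n hn
  have : IsSimpleGroup (alternatingGroup (Fin n)) :=
    alternatingGroup.isSimpleGroup (by simp; omega)
  have hnc : ∃ g h : alternatingGroup (Fin n), g * h ≠ h * g := by
    by_contra! h
    have h1 : IsMulCommutative (alternatingGroup (Fin n)) := ⟨⟨h⟩⟩
    rw [alternatingGroup.isMulCommutative_iff_card_le_three] at h1
    simp at h1
    omega
  obtain ⟨w, hw, hall⟩ := aux_word hnc p0 hp0 (p0 0)
  have hval : ∀ p : Fin 2 → alternatingGroup (Fin n), FreeGroup.lift p w = 1 ∨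
      (FreeGroup.lift p w : Perm (Fin n)).IsThreeCycle := by
    intro p
    rcases hall p with h | ⟨φ, h⟩
    · exact Or.inl h
    · right
      rw [h]
      exact aux_aut (by simpa using hn) φ _ ht
  refine ⟨w, ?_⟩
  ext g
  constructor
  · rintro ⟨p, h | h⟩
    · rw [← h]; exact hval p
    · have := hval p
      rw [h] at this
      rcases this with h | h
      · left; simpa using h
      · right
        simpa [IsThreeCycle] using h
  · rintro (rfl | hg)
    · refine ⟨1, Or.inl ?_⟩
      have : FreeGroup.lift (1 : Fin 2 → alternatingGroup (Fin n)) = 1 := by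
        ext i; simp
      rw [this]; rfl
    · obtain ⟨c, hc⟩ := isConj_iff.1
        (alternatingGroup.isThreeCycle_isConj (by simp; omega) ht hg)
      refine ⟨fun i => c * p0 i * c⁻¹, Or.inl ?_⟩
      have : FreeGroup.lift (fun i => c * p0 i * c⁻¹) =
          (MulAut.conj c).toMonoidHom.comp (FreeGroup.lift p0) := by
        ext i; simp
      rw [this, MonoidHom.comp_apply, hw, ← hc]
      simp
end

section
/- For every positive integer d and every group word w in the free group F_d, the set of values Alt(6)_w of w in the alternating group Alt(6) is not equal to the set consisting of the identity together with all 3-cycles. -/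
/-- Images of the transpositions under the outer automorphism of Sym(6). -/
def exM : Fin 6 → Fin 6 → Fin 6 → Fin 6 :=
  ![![![0, 1, 2, 3, 4, 5], ![1, 0, 3, 2, 5, 4], ![5, 3, 4, 1, 2, 0], ![4, 2, 1, 5, 0, 3], ![3, 4, 5, 0, 1, 2], ![2, 5, 0, 4, 3, 1]],
    ![![1, 0, 3, 2, 5, 4], ![0, 1, 2, 3, 4, 5], ![2, 4, 0, 5, 1, 3], ![3, 5, 4, 0, 2, 1], ![5, 2, 1, 4, 3, 0], ![4, 3, 5, 1, 0, 2]],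
    ![![5, 3, 4, 1, 2, 0], ![2, 4, 0, 5, 1, 3], ![0, 1, 2, 3, 4, 5], ![1, 0, 5, 4, 3, 2], ![4, 5, 3, 2, 0, 1], ![3, 2, 1, 0, 5, 4]],
    ![![4, 2, 1, 5, 0, 3], ![3, 5, 4, 0, 2, 1], ![1, 0, 5, 4, 3, 2], ![0, 1, 2, 3, 4, 5], ![2, 3, 0, 1, 5, 4], ![5, 4, 3, 2, 1, 0]],
    ![![3, 4, 5, 0, 1, 2], ![5, 2, 1, 4, 3, 0], ![4, 5, 3, 2, 0, 1], ![2, 3, 0, 1, 5, 4], ![0, 1, 2, 3, 4, 5], ![1, 0, 4, 5, 2, 3]],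
    ![![2, 5, 0, 4, 3, 1], ![4, 3, 5, 1, 0, 2], ![3, 2, 1, 0, 5, 4], ![5, 4, 3, 2, 1, 0], ![1, 0, 4, 5, 2, 3], ![0, 1, 2, 3, 4, 5]]]

theorem exM_inv : ∀ i j x, exM i j (exM i j x) = x := by decide

def exP (i j : Fin 6) : Equiv.Perm (Fin 6) := ⟨exM i j, exM i j, exM_inv i j, exM_inv i j⟩

theorem exP_sign : ∀ i j, i ≠ j → Equiv.Perm.sign (exP i j) = -1 := by decide +kernel

theorem exM_swap : ∀ i j a b x, exM i j (exM a b x) =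
    exM (Equiv.swap i j a) (Equiv.swap i j b) (exM i j x) := by decide +kernel

/-- The graph of the outer automorphism. -/
def exK : Subgroup (Equiv.Perm (Fin 6) × Equiv.Perm (Fin 6)) where
  carrier := {p | ∀ a b x, p.2 (exM a b x) = exM (p.1 a) (p.1 b) (p.2 x)}
  one_mem' := by intro a b x; rfl
  mul_mem' := by
    intro p q hp hq a b x
    have h1 := hq a b x
    have h2 := hp (q.1 a) (q.1 b) (q.2 x)
    simp only [Prod.fst_mul, Prod.snd_mul, Equiv.Perm.mul_apply]
    rw [h1, h2]
  inv_mem' := by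
    intro p hp a b x
    have h := hp (p.1⁻¹ a) (p.1⁻¹ b) (p.2⁻¹ x)
    have e : ∀ (s : Equiv.Perm (Fin 6)) y, s (s⁻¹ y) = y := fun s y => s.apply_symm_apply y
    rw [e, e, e] at h
    simp only [Prod.fst_inv, Prod.snd_inv]
    rw [← h]
    exact p.2.symm_apply_apply _

theorem exK_exists (σ : Equiv.Perm (Fin 6)) :
    ∃ τ, (σ, τ) ∈ exK ∧ Equiv.Perm.sign τ = Equiv.Perm.sign σ := by
  induction σ using Equiv.Perm.swap_induction_on with
  | one => exact ⟨1, exK.one_mem, rfl⟩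
  | swap_mul f x y hxy ih =>
    obtain ⟨τ, h, hs⟩ := ih
    refine ⟨exP x y * τ, ?_, ?_⟩
    · have h0 : (Equiv.swap x y, exP x y) ∈ exK := fun a b z => exM_swap x y a b z
      exact exK.mul_mem h0 h
    · rw [Equiv.Perm.sign_mul, Equiv.Perm.sign_mul, hs, exP_sign x y hxy,
        Equiv.Perm.sign_swap hxy]

theorem exM_orbit : ∀ x y, y = x ∨ y = exM 3 4 x ∨ y = exM 4 5 x ∨ y = exM 3 5 x ∨
    y = exM 3 4 (exM 4 5 x) ∨ y = exM 4 5 (exM 3 4 x) := by decide +kernel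

def exC : Equiv.Perm (Fin 6) := Equiv.swap 0 1 * Equiv.swap 1 2

theorem exC_three : exC.IsThreeCycle := by
  have h := Equiv.Perm.isThreeCycle_swap_mul_swap_same (a := (1 : Fin 6)) (b := 0) (c := 2)
    (by decide) (by decide) (by decide)
  rw [Equiv.swap_comm 1 0] at h
  exact h

theorem exK_not_fix (τ : Equiv.Perm (Fin 6)) (h : (exC, τ) ∈ exK) (x : Fin 6) : τ x ≠ x := by
  intro hx
  have h34 : ∀ y, τ (exM 3 4 y) = exM 3 4 (τ y) := fun y => h 3 4 y
  have h45 : ∀ y, τ (exM 4 5 y) = exM 4 5 (τ y) := fun y => h 4 5 y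
  have h35 : ∀ y, τ (exM 3 5 y) = exM 3 5 (τ y) := fun y => h 3 5 y
  have hall : ∀ y, τ y = y := by
    intro y
    rcases exM_orbit x y with rfl | rfl | rfl | rfl | rfl | rfl <;> simp only [h34, h45, h35, hx]
  have h01 := h 0 1 0
  simp only [hall] at h01
  exact absurd h01 (by decide +kernel)

theorem stmt4 (d : ℕ) (hd : 0 < d) (w : FreeGroup (Fin d)) :
    wordValues w (alternatingGroup (Fin 6)) ≠
      {g : alternatingGroup (Fin 6) | g = 1 ∨ (g : Equiv.Perm (Fin 6)).IsThreeCycle} := by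
  intro heq
  have key : ∀ f : Fin d → alternatingGroup (Fin 6), ∃ g : Fin d → alternatingGroup (Fin 6),
      (((FreeGroup.lift f w : alternatingGroup (Fin 6)) : Equiv.Perm (Fin 6)),
        ((FreeGroup.lift g w : alternatingGroup (Fin 6)) : Equiv.Perm (Fin 6))) ∈ exK := by
    intro f
    choose τ hτ hs using fun i => exK_exists (f i : Equiv.Perm (Fin 6))
    refine ⟨fun i => ⟨τ i, Equiv.Perm.mem_alternatingGroup.2
      ((hs i).trans (Equiv.Perm.mem_alternatingGroup.1 (f i).2))⟩, ?_⟩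
    clear heq
    induction w using FreeGroup.induction_on with
    | C1 => simp only [map_one]; exact exK.one_mem
    | of i => simpa using hτ i
    | inv_of i _ => simpa using exK.inv_mem (hτ i)
    | mul x y hx hy => simpa using exK.mul_mem (hx) (hy)
  let c : alternatingGroup (Fin 6) := ⟨exC, exC_three.mem_alternatingGroup⟩
  have hc : c ∈ wordValues w (alternatingGroup (Fin 6)) := by
    rw [heq]; exact Or.inr exC_three
  obtain ⟨f, hf⟩ := hc
  obtain ⟨g, hg⟩ := key f
  have hmem : ∃ v : alternatingGroup (Fin 6), v ∈ wordValues w (alternatingGroup (Fin 6)) ∧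
      (exC, (v : Equiv.Perm (Fin 6))) ∈ exK := by
    rcases hf with hf | hf
    · rw [hf] at hg
      exact ⟨_, ⟨g, Or.inl rfl⟩, hg⟩
    · rw [hf] at hg
      refine ⟨(FreeGroup.lift g w)⁻¹, ⟨g, Or.inr (inv_inv _).symm⟩, ?_⟩
      have := exK.inv_mem hg
      simpa [c] using this
  obtain ⟨v, hv, hvK⟩ := hmem
  rw [heq] at hv
  have hfix := exK_not_fix _ hvK
  rcases hv with rfl | hv
  · exact hfix 0 rfl
  · have h3 := hv.card_support
    have : (v : Equiv.Perm (Fin 6)).support = Finset.univ := by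
      ext x; simpa using hfix x
    rw [this] at h3
    simp at h3
end

section
/- For every natural number n ≥ 7 with n ≠ 13, there exists a group word w(x_1,x_2) in the free group F_2 on two generators such that the set of values Sym(n)_w of w in the symmetric group Sym(n) consists exactly of the identity and all 3-cycles. -/
lemma aux_fact (m j : ℕ) (hj : 1 ≤ j) (h : 2 ≤ m + j) :
    3 ^ j * (j + 1).factorial * m.factorial < (m + 3 * j).factorial := by
  have step : ∀ k, 1 ≤ k → 3 ^ k * (k + 1).factorial * m.factorial < (m + 3 * k).factorial →
      3 ^ (k+1) * (k + 1 + 1).factorial * m.factorial < (m + 3 * (k+1)).factorial := by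
    intro k hk ih
    have e : m + 3 * (k+1) = (m + 3 * k) + 1 + 1 + 1 := by ring
    rw [e, Nat.factorial_succ (m + 3*k+1+1), Nat.factorial_succ (m+3*k+1),
      Nat.factorial_succ (m+3*k), Nat.factorial_succ (k+1), pow_succ]
    have h1 : 3 * (k + 1 + 1) ≤ (m + 3*k+1+1+1) * ((m+3*k+1+1) * (m + 3*k+1)) := by
      nlinarith [Nat.zero_le (m * k), Nat.zero_le (m*m), Nat.zero_le (k*k), Nat.zero_le (m*m*m),
        Nat.zero_le (m*m*k), Nat.zero_le (m*k*k), Nat.zero_le (k*k*k)]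
    calc 3 ^ k * 3 * ((k + 1 + 1) * (k + 1).factorial) * m.factorial
        = (3 * (k+1+1)) * (3 ^ k * (k + 1).factorial * m.factorial) := by ring
      _ < (3 * (k+1+1)) * (m + 3 * k).factorial := by gcongr
      _ ≤ ((m + 3*k+1+1+1) * ((m+3*k+1+1) * (m + 3*k+1))) * (m + 3 * k).factorial := by gcongr
      _ = _ := by ring
  rcases Nat.eq_zero_or_pos m with rfl | hm
  · have hj : 2 ≤ j := by omega
    induction j, hj using Nat.le_induction with
    | base => decide
    | succ k hk ih => exact step k (by omega) (ih (by omega) (by omega))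
  · clear h
    induction j, hj using Nat.le_induction with
    | base =>
      rw [show m + 3 * 1 = m + 1 + 1 + 1 by ring, Nat.factorial_succ (m+1+1),
        Nat.factorial_succ (m+1), Nat.factorial_succ m]
      have := Nat.factorial_pos m
      have h1 : 6 < (m+1+1+1) * ((m+1+1) * (m+1)) := by nlinarith [Nat.zero_le (m*m), Nat.zero_le (m*m*m)]
      calc 3 ^ 1 * (1 + 1).factorial * m.factorial = 6 * m.factorial := by
            norm_num [Nat.factorial]
        _ < ((m+1+1+1) * ((m+1+1) * (m+1))) * m.factorial := by gcongr
        _ = _ := by ring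
    | succ k hk ih => exact step k hk ih

lemma centralizer_card_map {G : Type*} [Group G] (α : G ≃* G) (c : G) :
    Nat.card (Subgroup.centralizer {c}) = Nat.card (Subgroup.centralizer {α c}) := by
  refine Nat.card_congr (α.toEquiv.subtypeEquiv ?_)
  intro a
  simp only [Subgroup.mem_centralizer_singleton_iff]
  constructor
  · intro h
    have := congrArg α h
    simpa using this
  · intro h
    apply α.injective
    simpa using h

lemma threeCycle_map {n : ℕ} (hn : 7 ≤ n) (α : Equiv.Perm (Fin n) ≃* Equiv.Perm (Fin n))
    (c : Equiv.Perm (Fin n)) (hc : c.IsThreeCycle) : (α c).IsThreeCycle := by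
  have ho : orderOf (α c) = 3 := by rw [MulEquiv.orderOf_eq, hc.orderOf]
  obtain ⟨k, hk⟩ := Equiv.Perm.cycleType_prime_order (σ := α c) (by rw [ho]; norm_num)
  rw [ho] at hk
  have hcard := centralizer_card_map α c
  rw [Equiv.Perm.nat_card_centralizer, Equiv.Perm.nat_card_centralizer, hk, hc.cycleType] at hcard
  have hle : (α c).cycleType.sum ≤ n := by
    rw [Equiv.Perm.sum_cycleType]
    simpa using Finset.card_le_univ (α c).support
  rw [hk] at hle
  rcases Nat.eq_zero_or_pos k with rfl | hkp
  · exact hk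
  exfalso
  rw [Multiset.toFinset_replicate, if_neg (by omega)] at hcard
  simp only [Multiset.sum_replicate, Multiset.prod_replicate, Finset.prod_singleton,
    Multiset.count_replicate_self, Multiset.sum_singleton, Multiset.prod_singleton,
    Multiset.toFinset_singleton, Multiset.count_singleton_self, Fintype.card_fin, smul_eq_mul,
    Nat.factorial_one, mul_one] at hcard hle
  obtain ⟨m, rfl⟩ := Nat.exists_eq_add_of_le hle
  have := aux_fact m k hkp (by omega)
  rw [show (k + 1) * 3 + m - 3 = m + 3 * k by omega,
    show (k + 1) * 3 + m - (k + 1) * 3 = m by omega, pow_succ] at hcard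
  nlinarith

lemma exists_surj {n : ℕ} (hn : 7 ≤ n) :
    ∃ f : Fin 2 → Equiv.Perm (Fin n), Function.Surjective (FreeGroup.lift f) := by
  have : NeZero n := ⟨by omega⟩
  refine ⟨![finRotate n, Equiv.swap 0 (finRotate n 0)], ?_⟩
  rw [← MonoidHom.range_eq_top, FreeGroup.range_lift_eq_closure]
  rw [← Equiv.Perm.closure_cycle_adjacent_swap (isCycle_finRotate_of_le (by omega))
    (support_finRotate_of_le (by omega)) (0 : Fin n)]
  congr 1
  simp [Matrix.range_cons, Set.pair_comm]

lemma alt_perfect {n : ℕ} (hn : 7 ≤ n) :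
    ⁅alternatingGroup (Fin n), alternatingGroup (Fin n)⁆ = alternatingGroup (Fin n) := by
  have h := congrArg (Subgroup.map (alternatingGroup (Fin n)).subtype)
    (commutator_alternatingGroup_eq_top (α := Fin n) (by simp; omega))
  rw [commutator_def, Subgroup.map_commutator] at h
  simpa [← MonoidHom.range_eq_map] using h

lemma map_iInf_ge {n : ℕ} (hn : 7 ≤ n) {F : Type*} [Group F] (φ : F →* Equiv.Perm (Fin n))
    {ι : Type*} (K : ι → Subgroup F) (hK : ∀ i, (K i).Normal)
    (s : Finset ι) (hs : ∀ i ∈ s, alternatingGroup (Fin n) ≤ (K i).map φ)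
    (hφ : Function.Surjective φ) :
    ∃ M : Subgroup F, M.Normal ∧ (∀ i ∈ s, M ≤ K i) ∧ alternatingGroup (Fin n) ≤ M.map φ := by
  classical
  induction s using Finset.induction_on with
  | empty => exact ⟨⊤, inferInstance, by simp, by
      rw [Subgroup.map_top_of_surjective _ hφ]; exact le_top⟩
  | insert a s ha ih =>
    obtain ⟨M, hM, h1, h2⟩ := ih (fun i hi => hs i (Finset.mem_insert_of_mem hi))
    have := hK a
    refine ⟨⁅K a, M⁆, inferInstance, ?_, ?_⟩
    · intro i hi
      have hle := Subgroup.commutator_le_inf (K a) M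
      rcases Finset.mem_insert.1 hi with rfl | hi
      · exact hle.trans inf_le_left
      · exact (hle.trans inf_le_right).trans (h1 i hi)
    · rw [Subgroup.map_commutator, ← alt_perfect hn]
      exact Subgroup.commutator_mono (hs a (Finset.mem_insert_self _ _)) h2

theorem stmt5 (n : ℕ) (hn : 7 ≤ n) (h13 : n ≠ 13) :
    ∃ w : FreeGroup (Fin 2),
      wordValues w (Equiv.Perm (Fin n)) =
        {g : Equiv.Perm (Fin n) | g = 1 ∨ g.IsThreeCycle} := by
  classical
  obtain ⟨f₀, hf₀⟩ := exists_surj hn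
  have : NeZero n := ⟨by omega⟩
  obtain ⟨c, hc⟩ : ∃ c : Equiv.Perm (Fin n), c.IsThreeCycle :=
    ⟨_, Equiv.Perm.isThreeCycle_swap_mul_swap_same (a := ⟨0, by omega⟩) (b := ⟨1, by omega⟩)
      (c := (⟨2, by omega⟩ : Fin n))
      (by rw [Ne, Fin.mk.injEq]; decide) (by rw [Ne, Fin.mk.injEq]; decide)
      (by rw [Ne, Fin.mk.injEq]; decide)⟩
  let K : (Fin 2 → Equiv.Perm (Fin n)) → Subgroup (FreeGroup (Fin 2)) :=
    fun f => (FreeGroup.lift f).ker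
  obtain ⟨M, hM, hMK, hMA⟩ := map_iInf_ge hn (FreeGroup.lift f₀) K (fun f => inferInstance)
    (Finset.univ.filter fun f => ¬ K f ≤ K f₀) (by
      intro f hf
      have hf : ¬ K f ≤ K f₀ := by simpa using hf
      have : ((K f).map (FreeGroup.lift f₀)).Normal :=
        Subgroup.Normal.map inferInstance _ hf₀
      apply Equiv.Perm.alternatingGroup_le_of_normal (by simp; omega)
      rw [Subgroup.nontrivial_iff_ne_bot]
      intro h
      exact hf ((Subgroup.map_eq_bot_iff _).1 h)) hf₀
  obtain ⟨w, hwM, hw⟩ := hMA hc.mem_alternatingGroup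
  have key : ∀ f : Fin 2 → Equiv.Perm (Fin n), FreeGroup.lift f w = 1 ∨ (FreeGroup.lift f w).IsThreeCycle := by
    intro f
    by_cases hf : K f ≤ K f₀
    · right
      have hle : K f₀ ≤ K f := by
        have hm := Subgroup.relIndex_mul_index hf
        have i0 : (K f₀).index = Nat.card (Equiv.Perm (Fin n)) := by
          rw [Subgroup.index_ker, MonoidHom.range_eq_top.2 hf₀, Subgroup.card_top]
        have i1 : (K f).index ≤ Nat.card (Equiv.Perm (Fin n)) := by
          rw [Subgroup.index_ker]; exact Subgroup.card_le_card_group _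
        have i2 : 0 < (K f).index := by
          rw [Subgroup.index_ker]; exact Nat.card_pos
        rw [← Subgroup.relIndex_eq_one]
        have i3 : 0 < Nat.card (Equiv.Perm (Fin n)) := Nat.card_pos
        rw [i0] at hm
        rw [← hm] at i1 i2
        have := Nat.pos_of_mul_pos_right i2
        nlinarith
      let α : Equiv.Perm (Fin n) →* Equiv.Perm (Fin n) :=
        (FreeGroup.lift f₀).liftOfSurjective hf₀ ⟨FreeGroup.lift f, hle⟩
      have hα : ∀ x, α (FreeGroup.lift f₀ x) = FreeGroup.lift f x := fun x =>
        MonoidHom.liftOfRightInverse_comp_apply _ _ _ ⟨FreeGroup.lift f, hle⟩ x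
      have hinj : Function.Injective α := by
        rw [injective_iff_map_eq_one]
        intro a ha
        obtain ⟨x, rfl⟩ := hf₀ a
        rw [hα] at ha
        exact hf ha
      have := threeCycle_map hn (MulEquiv.ofBijective α (Finite.injective_iff_bijective.1 hinj)) c hc
      rw [← hα, hw]
      exact this
    · left
      exact hMK f (by simpa using hf) hwM
  refine ⟨w, Set.ext fun g => ⟨?_, ?_⟩⟩
  · rintro ⟨f, h | h⟩
    · have := key f
      rw [h] at this
      exact this
    · have := key f
      rw [h] at this
      simpa [Equiv.Perm.IsThreeCycle] using this
  · rintro (rfl | hg)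
    · refine ⟨fun _ => 1, Or.inl ?_⟩
      have : FreeGroup.lift (fun _ : Fin 2 => (1 : Equiv.Perm (Fin n))) = 1 := by
        ext; simp
      rw [this]; rfl
    · obtain ⟨t, ht⟩ := isConj_iff.1
        (Equiv.Perm.isConj_iff_cycleType_eq.2 (hc.cycleType.trans hg.cycleType.symm))
      refine ⟨fun i => t * f₀ i * t⁻¹, Or.inl ?_⟩
      have : FreeGroup.lift (fun i => t * f₀ i * t⁻¹) =
          (MulAut.conj t).toMonoidHom.comp (FreeGroup.lift f₀) := by
        ext; simp
      rw [this, ← ht, ← hw]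
      simp
end

section
/- Let w be a group word in the free group F_d and let n ≥ 4. If some value of w in the symmetric group Sym(n) is an odd permutation, then every involution of Sym(n) is a value of w. Consequently, there is no group word w (in any number of variables) whose set of values in Sym(n) equals the set consisting of the identity together with all transpositions. -/
theorem exists_unit_hom {G : Type*} [Group G] (t : G) (ht : t * t = 1) :
    ∃ φ : ℤˣ →* G, φ (-1) = t := by
  refine ⟨{ toFun := fun u => if u = 1 then 1 else t, map_one' := by simp, map_mul' := ?_ }, ?_⟩
  · intro x y
    rcases Int.units_eq_one_or x with rfl | rfl <;> rcases Int.units_eq_one_or y with rfl | rfl <;>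
      simp [ht]
  · simp

theorem odd_value_aux (n : ℕ) (d : ℕ) (w : FreeGroup (Fin d))
    (h : ∃ g ∈ wordValues w (Equiv.Perm (Fin n)), Equiv.Perm.sign g = -1)
    (t : Equiv.Perm (Fin n)) (ht : t * t = 1) : t ∈ wordValues w (Equiv.Perm (Fin n)) := by
  obtain ⟨g, ⟨f, hf⟩, hg⟩ := h
  obtain ⟨φ, hφ⟩ := exists_unit_hom t ht
  have hs : Equiv.Perm.sign (FreeGroup.lift f w) = -1 := by
    rcases hf with hf | hf <;> rw [hf]
    · exact hg
    · rw [Equiv.Perm.sign_inv, hg]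
  refine ⟨fun i => φ (Equiv.Perm.sign (f i)), Or.inl ?_⟩
  have key : FreeGroup.lift (fun i => φ (Equiv.Perm.sign (f i))) =
      (φ.comp Equiv.Perm.sign).comp (FreeGroup.lift f) := by
    ext1 i
    simp
  rw [key]
  simp [hs, hφ]

theorem stmt6 (n : ℕ) (hn : 4 ≤ n) :
    (∀ (d : ℕ) (w : FreeGroup (Fin d)),
      (∃ g ∈ wordValues w (Equiv.Perm (Fin n)), Equiv.Perm.sign g = -1) →
      ∀ g : Equiv.Perm (Fin n), orderOf g = 2 → g ∈ wordValues w (Equiv.Perm (Fin n))) ∧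
    (∀ (d : ℕ) (w : FreeGroup (Fin d)),
      wordValues w (Equiv.Perm (Fin n)) ≠
        {g : Equiv.Perm (Fin n) | g = 1 ∨ g.IsSwap}) := by
  refine ⟨fun d w h g hg => odd_value_aux n d w h g ?_, fun d w h => ?_⟩
  · rw [← pow_two, ← hg, pow_orderOf_eq_one]
  · let a : Fin n := ⟨0, by omega⟩
    let b : Fin n := ⟨1, by omega⟩
    let c : Fin n := ⟨2, by omega⟩
    let e : Fin n := ⟨3, by omega⟩
    have hab : a ≠ b := by simp [a, b]
    have hac : a ≠ c := by simp [a, c]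
    have hae : a ≠ e := by simp [a, e]
    have hbc : b ≠ c := by simp [b, c]
    have hbe : b ≠ e := by simp [b, e]
    have hce : c ≠ e := by simp [c, e]
    have hcomm : Equiv.swap a b * Equiv.swap c e = Equiv.swap c e * Equiv.swap a b := by
      apply Equiv.Perm.Disjoint.commute
      intro x
      by_cases h1 : x = a
      · right; subst h1; exact Equiv.swap_apply_of_ne_of_ne hac hae
      by_cases h2 : x = b
      · right; subst h2; exact Equiv.swap_apply_of_ne_of_ne hbc hbe
      left; exact Equiv.swap_apply_of_ne_of_ne h1 h2
    have hmem := odd_value_aux n d w ⟨Equiv.swap a b, by rw [h]; exact Or.inr ⟨a, b, hab, rfl⟩,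
      Equiv.Perm.sign_swap hab⟩ (Equiv.swap a b * Equiv.swap c e) (by
        nth_rewrite 2 [hcomm]
        rw [mul_assoc, ← mul_assoc (Equiv.swap c e)]
        simp)
    rw [h] at hmem
    rcases hmem with h1 | h1
    · have := congrArg (fun p : Equiv.Perm (Fin n) => p a) h1
      simp only [Equiv.Perm.mul_apply, Equiv.swap_apply_of_ne_of_ne hac hae,
        Equiv.swap_apply_left, Equiv.Perm.one_apply] at this
      exact hab this.symm
    · have h2 := h1.sign_eq
      rw [Equiv.Perm.sign_mul, Equiv.Perm.sign_swap hab, Equiv.Perm.sign_swap hce] at h2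
      exact absurd h2 (by decide)
end

section
/- For each natural number n > 7 with n ≠ 13, there exist k ≥ 1 and prime numbers p_1 > p_2 > … > p_k > 3 such that n − (p_1 + … + p_k) ∈ {3,4,5} and, for each i = 1,…,k, p_i > (n − (p_1 + … + p_{i−1}))/2. -/
theorem aux_pow (L : ℕ) (h : 15 ≤ L) : 16 * L ^ 2 ≤ 2 ^ (L - 1) := by
  induction L, h using Nat.le_induction with
  | base => norm_num
  | succ L hL ih =>
    have e : L + 1 - 1 = (L - 1) + 1 := by omega
    rw [e, pow_succ 2 (L - 1)]
    nlinarith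

theorem aux_ineq (m : ℕ) (hm : 8192 ≤ m) :
    m * ((2 * m) ^ (Nat.sqrt (2 * m) + 14) * 4 ^ (2 * m / 3)) ≤ 4 ^ m := by
  set s := Nat.sqrt (2 * m) with hs
  have hs1 : s * s ≤ 2 * m := Nat.sqrt_le _
  have hs2 : 2 * m < (s + 1) * (s + 1) := Nat.lt_succ_sqrt _
  have hs3 : 128 ≤ s := by
    rw [hs, Nat.le_sqrt]; omega
  set L := Nat.log 2 (2 * m) + 1 with hL
  have hL1 : 2 * m < 2 ^ L := Nat.lt_pow_succ_log_self (by norm_num) _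
  have hL2 : 2 ^ (L - 1) ≤ 2 * m := by
    rw [hL, Nat.add_sub_cancel]; exact Nat.pow_log_le_self 2 (by omega)
  have hL3 : 15 ≤ L := by
    by_contra h
    have : 2 ^ L ≤ 2 ^ 14 := Nat.pow_le_pow_right (by norm_num) (by omega)
    omega
  have hLs : 4 * L ≤ s := by
    by_contra h
    have h1 := aux_pow L hL3
    have h2 : s + 1 ≤ 4 * L := by omega
    nlinarith
  have key : 3 * (L * (s + 15)) ≤ 2 * m := by nlinarith
  have key2 : L * (s + 15) + 2 * (2 * m / 3) ≤ 2 * m := by omega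
  calc m * ((2 * m) ^ (s + 14) * 4 ^ (2 * m / 3))
      ≤ (2 * m) * ((2 * m) ^ (s + 14) * 4 ^ (2 * m / 3)) := by gcongr; omega
    _ = (2 * m) ^ (s + 15) * 4 ^ (2 * m / 3) := by ring
    _ ≤ (2 ^ L) ^ (s + 15) * 4 ^ (2 * m / 3) := by gcongr
    _ = 2 ^ (L * (s + 15) + 2 * (2 * m / 3)) := by
        rw [pow_add 2 (L * (s + 15)), pow_mul, pow_mul 2 2]; norm_num
    _ ≤ 2 ^ (2 * m) := Nat.pow_le_pow_right (by norm_num) key2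
    _ = 4 ^ m := by rw [pow_mul]; norm_num

open Nat in
theorem aux_binom (n : ℕ) (n_large : 14 < n)
    (no_prime : ∀ p : ℕ, p.Prime → n < p → 2 * n < p + 14) :
    centralBinom n ≤ (2 * n) ^ (sqrt (2 * n) + 14) * 4 ^ (2 * n / 3) := by
  have n_pos : 0 < n := by omega
  have n2_pos : 1 ≤ 2 * n := by omega
  let S := {p ∈ Finset.range (2 * n / 3 + 1) | Nat.Prime p}
  let f x := x ^ n.centralBinom.factorization x
  have this : ∏ x ∈ S, f x = ∏ x ∈ Finset.range (2 * n / 3 + 1), f x := by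
    refine Finset.prod_filter_of_ne fun p _ h => ?_
    contrapose h; dsimp only [f]
    rw [factorization_eq_zero_of_not_prime n.centralBinom h, _root_.pow_zero]
  have hf : ∀ p, f p ≤ 2 * n := fun p => pow_factorization_choose_le (by omega)
  have e0 : n.centralBinom = (∏ x ∈ Finset.range (2 * n / 3 + 1), f x) *
      ∏ x ∈ Finset.Ioc (2 * n - 14) (2 * n), f x := by
    rw [← Finset.prod_union]
    · refine (Eq.trans ?_ n.prod_pow_factorization_centralBinom).symm
      apply Finset.prod_subset
      · intro x hx
        simp only [Finset.mem_union, Finset.mem_range, Finset.mem_Ioc] at hx ⊢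
        omega
      intro x hx h2x
      simp only [Finset.mem_union, Finset.mem_range, Finset.mem_Ioc] at hx h2x
      show x ^ n.centralBinom.factorization x = 1
      by_cases hp : x.Prime
      · have h := no_prime x hp
        rw [factorization_centralBinom_of_two_mul_self_lt_three_mul (by omega) (by omega)
          (by omega), Nat.pow_zero]
      · rw [factorization_eq_zero_of_not_prime n.centralBinom hp, Nat.pow_zero]
    · rw [Finset.disjoint_left]
      intro x hx h2x
      simp only [Finset.mem_range, Finset.mem_Ioc] at hx h2x
      omega
  have e1 : ∏ x ∈ Finset.Ioc (2 * n - 14) (2 * n), f x ≤ (2 * n) ^ 14 := by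
    refine (Finset.prod_le_prod' fun p _ => hf p).trans ?_
    rw [Finset.prod_const, Nat.card_Ioc]
    exact pow_right_mono₀ n2_pos (by omega)
  have e2 : ∏ x ∈ S, f x ≤ (2 * n) ^ sqrt (2 * n) * 4 ^ (2 * n / 3) := by
    rw [← Finset.prod_filter_mul_prod_filter_not S (· ≤ sqrt (2 * n))]
    apply mul_le_mul'
    · refine (Finset.prod_le_prod' fun p _ => hf p).trans ?_
      have : (Finset.Icc 1 (sqrt (2 * n))).card = sqrt (2 * n) := by
        rw [card_Icc, Nat.add_sub_cancel]
      rw [Finset.prod_const]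
      refine pow_right_mono₀ n2_pos ((Finset.card_le_card fun x hx => ?_).trans this.le)
      obtain ⟨h1, h2⟩ := Finset.mem_filter.1 hx
      exact Finset.mem_Icc.mpr ⟨(Finset.mem_filter.1 h1).2.one_lt.le, h2⟩
    · refine le_trans ?_ (primorial_le_four_pow (2 * n / 3))
      refine (Finset.prod_le_prod' fun p hp => (?_ : f p ≤ p)).trans ?_
      · obtain ⟨h1, h2⟩ := Finset.mem_filter.1 hp
        refine (pow_right_mono₀ (Finset.mem_filter.1 h1).2.one_lt.le ?_).trans (pow_one p).le
        exact Nat.factorization_choose_le_one (sqrt_lt'.mp <| not_le.1 h2)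
      refine Finset.prod_le_prod_of_subset_of_one_le' (Finset.filter_subset _ _) ?_
      exact fun p hp _ => (Finset.mem_filter.1 hp).2.one_lt.le
  rw [e0, ← this]
  refine (Nat.mul_le_mul e2 e1).trans (le_of_eq ?_)
  ring

theorem aux_large (m : ℕ) (hm : 8192 ≤ m) : ∃ p : ℕ, p.Prime ∧ m < p ∧ p + 14 ≤ 2 * m := by
  have h := Nat.four_pow_lt_mul_centralBinom m (by omega)
  contrapose! h
  exact (Nat.mul_le_mul_left m (aux_binom m (by omega) h)).trans (aux_ineq m hm)

theorem aux_step (n : ℕ) (hn : 7 < n) (h13 : n ≠ 13) :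
    ∃ p r : ℕ, p.Prime ∧ 3 < p ∧ n < 2 * p ∧ n = p + r ∧
      (r = 3 ∨ r = 4 ∨ r = 5 ∨ (7 < r ∧ r ≠ 13)) := by
  by_cases hl : 16384 ≤ n
  · obtain ⟨p, hp, h1, h2⟩ := aux_large (n / 2) (by omega)
    exact ⟨p, n - p, hp, by omega, by omega, by omega, by omega⟩
  · by_contra! hc
    have H : ∀ p : ℕ, p.Prime → 3 < p → n < 2 * p → p + 3 ≤ n → n ≠ p + 6 → n ≠ p + 7 →
        n ≠ p + 13 → False := by
      intro p hp h3 h1 h2 h4 h5 h6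
      have := hc p (n - p) hp h3 h1 (by omega)
      omega
    have a1 := H 5 (by norm_num)
    have a2 := H 7 (by norm_num)
    have a3 := H 11 (by norm_num)
    have a4 := H 13 (by norm_num)
    have a5 := H 17 (by norm_num)
    have a6 := H 19 (by norm_num)
    have a7 := H 23 (by norm_num)
    by_cases hs : n < 31
    · interval_cases n <;> simp_all
    clear a1 a2 a3 a4 a5 a6 a7
    have G : ∀ p : ℕ, p.Prime → ¬ (17 ≤ p ∧ n < 2 * p ∧ p + 14 ≤ n) := by
      rintro p hp ⟨h3, h1, h2⟩
      exact H p hp (by omega) h1 (by omega) (by omega) (by omega) (by omega)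
    have a5 := G 17 (by norm_num)
    have a6 := G 19 (by norm_num)
    have a7 := G 23 (by norm_num)
    have b1 := G 31 (by norm_num)
    have b2 := G 47 (by norm_num)
    have b3 := G 79 (by norm_num)
    have b4 := G 139 (by norm_num)
    have b5 := G 263 (by norm_num)
    have b6 := G 509 (by norm_num)
    have b7 := G 997 (by norm_num)
    have b8 := G 1979 (by norm_num)
    have b9 := G 3943 (by norm_num)
    have b10 := G 7867 (by norm_num)
    have b11 := G 8209 (by norm_num)
    clear hc H G
    omega

theorem stmt8 (n : ℕ) (hn : 7 < n) (h13 : n ≠ 13) :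
    ∃ (k : ℕ) (p : Fin k → ℕ), 1 ≤ k ∧
      (∀ i, (p i).Prime) ∧ (∀ i, 3 < p i) ∧ StrictAnti p ∧
      (n - ∑ i, p i) ∈ ({3, 4, 5} : Set ℕ) ∧
      ∀ i : Fin k, n < 2 * p i + ∑ j ∈ Finset.univ.filter (· < i), p j := by
  induction n using Nat.strong_induction_on with
  | _ n ih =>
  obtain ⟨p, r, hp, h3, h2, hr, hc⟩ := aux_step n hn h13
  by_cases hsm : r = 3 ∨ r = 4 ∨ r = 5
  · refine ⟨1, fun _ => p, le_rfl, fun _ => hp, fun _ => h3, Subsingleton.strictAnti _, ?_, ?_⟩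
    · simp; omega
    · intro i; show n < 2 * p + _; omega
  · obtain ⟨k, q, hk, hq, hq3, hqa, hqs, hqi⟩ := ih r (by omega) (by omega) (by omega)
    have hlt : ∀ i, q i < p := by
      intro i
      have := Finset.single_le_sum (f := q) (fun _ _ => Nat.zero_le _) (Finset.mem_univ i)
      simp only [Set.mem_insert_iff, Set.mem_singleton_iff] at hqs
      omega
    refine ⟨k + 1, Fin.cons p q, by omega, ?_, ?_, ?_, ?_, ?_⟩
    · intro i; refine Fin.cases ?_ (fun i => ?_) i
      · simpa using hp
      · simpa using hq i
    · intro i; refine Fin.cases ?_ (fun i => ?_) i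
      · simpa using h3
      · simpa using hq3 i
    · intro i j
      refine Fin.cases ?_ (fun i => ?_) i <;> refine Fin.cases ?_ (fun j => ?_) j
      · simp
      · intro _; simpa using hlt j
      · simp
      · intro h; simpa using hqa (Fin.succ_lt_succ_iff.1 h)
    · rw [Fin.sum_univ_succ]
      simp only [Fin.cons_zero, Fin.cons_succ]
      have : n - (p + ∑ i, q i) = r - ∑ i, q i := by omega
      rw [this]; exact hqs
    · intro i
      refine Fin.cases ?_ (fun i => ?_) i
      · simp only [Fin.cons_zero]; omega
      · have := hqi i
        rw [Finset.sum_filter] at this ⊢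
        rw [Fin.sum_univ_succ]
        simp only [Fin.cons_zero, Fin.cons_succ, Fin.succ_lt_succ_iff, Fin.succ_pos, if_true]
        omega
end

section
/- Let n ≥ 7 and let p_1 > p_2 > … > p_k > 3 be primes with n − (p_1 + … + p_k) ∈ {3,4,5} and p_i > (n − (p_1 + … + p_{i−1}))/2 for each i = 1,…,k; set p_0 = 3. Then there exist an element y of the alternating group Alt(n) and pairwise disjoint cycles a_0, a_1, …, a_k in Alt(n), where a_i is a cycle of length p_i, such that the commutator [a_0^{v}, a_0] is a 3-cycle, where v = [⋯[[y,a_1],a_2],⋯,a_k] is the left-normed commutator of y with a_1,…,a_k. -/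
def s9comm {α : Type*} (acc g : Equiv.Perm α) : Equiv.Perm α := acc⁻¹ * g⁻¹ * acc * g

def s9Good {α : Type*} [Fintype α] [DecidableEq α] (d0 d1 d2 : α) :
    List (Equiv.Perm α) → Finset α → Prop
  | [], T => d0 ∈ T ∧ d1 ∈ T ∧ d2 ∈ T ∧ T.card ≤ 5
  | a :: L, T => a.IsCycle ∧ a.support ⊆ T ∧ (T \ a.support).card ≤ a.support.card ∧
      5 ≤ a.support.card ∧ s9Good d0 d1 d2 L (T \ a.support)

def s9Final {α : Type*} (d0 d1 d2 : α) (v : Equiv.Perm α) : Prop :=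
  v d0 = d1 ∧ (v d1 ≠ d0 ∧ v d1 ≠ d1 ∧ v d1 ≠ d2) ∧ (v d2 ≠ d0 ∧ v d2 ≠ d1 ∧ v d2 ≠ d2)

def s9Chain : List ℕ → ℕ → Prop
  | [], m => 3 ≤ m ∧ m ≤ 5
  | p :: ps, m => 5 ≤ p ∧ p ≤ m ∧ m ≤ 2 * p ∧ s9Chain ps (m - p)

theorem s9enum {α : Type*} [DecidableEq α] (S : Finset α) :
    ∃ e : α → ℕ, Set.InjOn e S ∧ ∀ x ∈ S, e x < S.card := by
  refine ⟨fun x => if h : x ∈ S then (S.equivFin ⟨x, h⟩ : ℕ) else 0, ?_, ?_⟩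
  · intro x hx y hy hxy
    have hx' : x ∈ S := hx
    have hy' : y ∈ S := hy
    simp only [hx', hy', dite_true] at hxy
    have := S.equivFin.injective (Fin.ext hxy)
    simpa using this
  · intro x hx
    simp only [hx, dite_true]
    exact (S.equivFin ⟨x, hx⟩).2

theorem s9place {α : Type*} [Fintype α] [DecidableEq α] (a : Equiv.Perm α) (ha : a.IsCycle)
    (R : Finset α) (g : α → ℕ) (hg : Set.InjOn g R) (hlt : ∀ x ∈ R, g x < a.support.card) :
    ∃ f : α → α, Set.InjOn f R ∧ (∀ x ∈ R, f x ∈ a.support) ∧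
      (∀ x ∈ R, ∀ z ∈ R, g z = g x + 1 → a⁻¹ (f x) = f z) ∧
      (∀ x ∈ R, ∀ z ∈ R, a⁻¹ (f x) = f z →
        g z = g x + 1 ∨ (g x + 1 = a.support.card ∧ g z = 0)) := by
  have hb : a⁻¹.IsCycle := ha.inv
  have hbs : a⁻¹.support = a.support := Equiv.Perm.support_inv a
  obtain ⟨x0, hx0, -⟩ := id hb
  have hinj : ∀ i j : ℕ, i < a.support.card → j < a.support.card →
      (a⁻¹ ^ i) x0 = (a⁻¹ ^ j) x0 → i = j := by
    intro i j hi hj h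
    have h1 : a⁻¹ ^ i = a⁻¹ ^ j := (hb.pow_eq_pow_iff).2 ⟨x0, hx0, h⟩
    have ho : orderOf a⁻¹ = a.support.card := by rw [hb.orderOf, hbs]
    exact pow_injOn_Iio_orderOf (by simpa [ho] using hi) (by simpa [ho] using hj) h1
  have hcard : (a⁻¹ ^ a.support.card) x0 = x0 := by
    rw [← hbs, ← hb.orderOf, pow_orderOf_eq_one]; rfl
  refine ⟨fun x => (a⁻¹ ^ g x) x0, ?_, ?_, ?_, ?_⟩
  · intro x hx y hy h
    exact hg hx hy (hinj _ _ (hlt x hx) (hlt y hy) h)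
  · intro x hx
    rw [← hbs, Equiv.Perm.pow_apply_mem_support]
    exact Equiv.Perm.mem_support.2 hx0
  · intro x hx z hz h
    simp only [h, pow_succ']; rfl
  · intro x hx z hz h
    have h' : (a⁻¹ ^ (g x + 1)) x0 = (a⁻¹ ^ g z) x0 := by rw [pow_succ']; exact h
    rcases Nat.lt_or_ge (g x + 1) a.support.card with h1 | h1
    · left; exact (hinj _ _ h1 (hlt z hz) h').symm
    · right
      have h2 : g x + 1 = a.support.card := le_antisymm (hlt x hx) h1
      refine ⟨h2, ?_⟩
      rw [h2, hcard] at h'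
      exact (hinj 0 (g z) (by omega) (hlt z hz) (by simpa using h')).symm

theorem s9key {α : Type*} [Fintype α] [DecidableEq α] (d0 d1 d2 : α)
    (h01 : d0 ≠ d1) (h02 : d0 ≠ d2) (h12 : d1 ≠ d2) :
    ∀ (L : List (Equiv.Perm α)) (a : Equiv.Perm α) (T : Finset α), s9Good d0 d1 d2 (a :: L) T →
    ∃ f : α → α, Set.InjOn f (T \ a.support : Finset α) ∧
      (∀ x ∈ T \ a.support, f x ∈ a.support) ∧
      ∀ v : Equiv.Perm α, (∀ x ∈ T \ a.support, v x = f x) →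
        s9Final d0 d1 d2 (L.foldl s9comm (s9comm v a)) := by
  have hv1 : ∀ (a v : Equiv.Perm α) (x z : α), x ∉ a.support →
      (s9comm v a x = z ↔ a⁻¹ (v x) = v z) := by
    intro a v x z hx
    have : a x = x := by simpa using hx
    simp only [s9comm, Equiv.Perm.mul_apply, this]
    rw [Equiv.Perm.inv_eq_iff_eq (f := v)]
  intro L
  induction L with
  | nil =>
    intro a T hT
    obtain ⟨ha, hsub, hc, h5, m0, m1, m2, hc5⟩ := hT
    set R := T \ a.support with hR
    obtain ⟨e, he, hel⟩ := s9enum (R \ {d0, d1, d2})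
    have hE : (R \ {d0, d1, d2}).card ≤ 2 := by
      have : ({d0, d1, d2} : Finset α) ⊆ R := by
        intro x; simp only [Finset.mem_insert, Finset.mem_singleton]
        rintro (rfl | rfl | rfl) <;> assumption
      rw [Finset.card_sdiff_of_subset this, Finset.card_eq_three.2 ⟨d0, d1, d2, h01, h02, h12, rfl⟩]
      omega
    have hel2 : ∀ x ∈ R, x ≠ d0 → x ≠ d1 → x ≠ d2 → e x < 2 := by
      intro x hx _ _ _
      exact lt_of_lt_of_le (hel x (by simp_all)) hE
    have hei : ∀ x ∈ R, x ≠ d0 → x ≠ d1 → x ≠ d2 → ∀ y ∈ R, y ≠ d0 → y ≠ d1 → y ≠ d2 →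
        e x = e y → x = y := by
      intro x hx _ _ _ y hy _ _ _ h
      exact he (by simp_all) (by simp_all) h
    let g : α → ℕ := fun x => if x = d0 then 0 else if x = d1 then 1 else if x = d2 then 3
      else 2 + 2 * e x
    have g0 : g d0 = 0 := by simp [g]
    have g1 : g d1 = 1 := by simp [g, h01.symm]
    have g2 : g d2 = 3 := by simp [g, h02.symm, h12.symm]
    have hcase : ∀ x ∈ R, x = d0 ∨ x = d1 ∨ x = d2 ∨
        ((x ≠ d0 ∧ x ≠ d1 ∧ x ≠ d2) ∧ e x < 2 ∧ g x = 2 + 2 * e x) := by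
      intro x hx
      by_cases c0 : x = d0
      · exact Or.inl c0
      by_cases c1 : x = d1
      · exact Or.inr (Or.inl c1)
      by_cases c2 : x = d2
      · exact Or.inr (Or.inr (Or.inl c2))
      exact Or.inr (Or.inr (Or.inr ⟨⟨c0, c1, c2⟩, hel2 x hx c0 c1 c2, by simp [g, c0, c1, c2]⟩))
    clear_value g
    have ginj : Set.InjOn g R := by
      intro x hx y hy hxy
      rcases hcase x hx with u | u | u | ⟨⟨u1, u2, u3⟩, u4, u5⟩ <;>
      rcases hcase y hy with w | w | w | ⟨⟨w1, w2, w3⟩, w4, w5⟩ <;>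
      first
      | exact u.trans w.symm
      | exact hei x hx u1 u2 u3 y hy w1 w2 w3 (by omega)
      | (exfalso; rw [u, w] at hxy; omega)
      | (exfalso; rw [u] at hxy; omega)
      | (exfalso; rw [w] at hxy; omega)
    obtain ⟨f, f1, f2, f3, f4⟩ := s9place a ha R g ginj
      (by
        intro x hx
        rcases hcase x hx with u | u | u | ⟨-, u4, u5⟩
        · rw [u]; omega
        · rw [u]; omega
        · rw [u]; omega
        · omega)
    refine ⟨f, f1, f2, ?_⟩
    intro v hv
    have hR' : ∀ x ∈ R, x ∉ a.support := fun x hx => (Finset.mem_sdiff.1 hx).2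
    have hne : ∀ x ∈ R, ∀ z ∈ R, s9comm v a x = z → 
        g z = g x + 1 ∨ (g x + 1 = a.support.card ∧ g z = 0) := by
      intro x hx z hz h
      rw [hv1 a v x z (hR' x hx), hv x hx, hv z hz] at h
      exact f4 x hx z hz h
    simp only [List.foldl_nil]
    refine ⟨?_, ⟨?_, ?_, ?_⟩, ?_, ?_, ?_⟩
    · rw [hv1 a v _ _ (hR' _ m0), hv _ m0, hv _ m1]
      exact f3 _ m0 _ m1 (by omega)
    · intro h; have := hne _ m1 _ m0 h; omega
    · intro h; have := hne _ m1 _ m1 h; omega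
    · intro h; have := hne _ m1 _ m2 h; omega
    · intro h; have := hne _ m2 _ m0 h; omega
    · intro h; have := hne _ m2 _ m1 h; omega
    · intro h; have := hne _ m2 _ m2 h; omega
  | cons b L ih =>
    intro a T hT
    obtain ⟨ha, hsub, hc, h5, hG⟩ := hT
    obtain ⟨f', i1, i2, i3⟩ := ih b _ hG
    obtain ⟨hb, hbsub, -⟩ := hG
    set R := T \ a.support with hR
    set R' := R \ b.support with hR'
    obtain ⟨e, he, hel⟩ := s9enum R'
    set I := R'.image f' with hI
    obtain ⟨e2, he2, hel2⟩ := s9enum (R \ (R' ∪ I))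
    have hIb : I ⊆ b.support := by
      intro x hx
      obtain ⟨r, hr, rfl⟩ := Finset.mem_image.1 hx
      exact i2 r hr
    have hdisj : Disjoint R' I := by
      rw [Finset.disjoint_left]
      intro x hx hx2
      exact (Finset.mem_sdiff.1 hx).2 (hIb hx2)
    have hIc : I.card = R'.card := Finset.card_image_of_injOn i1
    have hsubR : R' ∪ I ⊆ R :=
      Finset.union_subset Finset.sdiff_subset (hIb.trans hbsub)
    have hcu : (R' ∪ I).card = R'.card + R'.card := by
      rw [Finset.card_union_of_disjoint hdisj, hIc]
    have hle := Finset.card_le_card hsubR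
    have hcr : (R \ (R' ∪ I)).card = R.card - (R'.card + R'.card) := by
      rw [Finset.card_sdiff_of_subset hsubR, hcu]
    rw [hcr] at hel2
    have hinv : ∀ x ∈ I, ∃ r ∈ R', f' r = x := fun x hx => Finset.mem_image.1 hx
    choose! s hs1 hs2 using hinv
    let g : α → ℕ := fun x => if x ∈ R' then 2 * e x else if x ∈ I then 2 * e (s x) + 1
      else 2 * R'.card + e2 x
    have gR : ∀ x ∈ R', g x = 2 * e x := fun x hx => by simp [g, hx]
    have gI : ∀ x ∈ I, g x = 2 * e (s x) + 1 := fun x hx => by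
      have : x ∉ R' := Finset.disjoint_right.1 hdisj hx
      simp [g, hx, this]
    have gO : ∀ x, x ∉ R' → x ∉ I → g x = 2 * R'.card + e2 x := fun x h1 h2 => by
      simp [g, h1, h2]
    have hcase : ∀ x ∈ R, (x ∈ R' ∧ e x < R'.card ∧ g x = 2 * e x) ∨
        (x ∈ I ∧ e (s x) < R'.card ∧ g x = 2 * e (s x) + 1) ∨
        (x ∈ R \ (R' ∪ I) ∧ e2 x < R.card - (R'.card + R'.card) ∧ g x = 2 * R'.card + e2 x) := by
      intro x hx
      by_cases h1 : x ∈ R'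
      · exact Or.inl ⟨h1, hel x h1, gR x h1⟩
      · by_cases h2 : x ∈ I
        · exact Or.inr (Or.inl ⟨h2, hel _ (hs1 x h2), gI x h2⟩)
        · have h3 : x ∈ R \ (R' ∪ I) := by simp [hx, h1, h2]
          exact Or.inr (Or.inr ⟨h3, hel2 x h3, gO x h1 h2⟩)
    obtain ⟨f, f1, f2, f3, -⟩ := s9place a ha R g
      (by
        intro x hx y hy hxy
        rcases hcase x hx with ⟨u1, u2, u3⟩ | ⟨u1, u2, u3⟩ | ⟨u1, u2, u3⟩ <;>
        rcases hcase y hy with ⟨w1, w2, w3⟩ | ⟨w1, w2, w3⟩ | ⟨w1, w2, w3⟩ <;>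
        first
        | omega
        | exact he u1 w1 (by omega)
        | exact he2 u1 w1 (by omega)
        | (have := he (hs1 x u1) (hs1 y w1) (by omega)
           rw [← hs2 x u1, ← hs2 y w1, this]))
      (by
        intro x hx
        rcases hcase x hx with ⟨u1, u2, u3⟩ | ⟨u1, u2, u3⟩ | ⟨u1, u2, u3⟩ <;> omega)
    refine ⟨f, f1, f2, ?_⟩
    intro v hv
    rw [List.foldl_cons]
    apply i3
    intro x hx
    have hxR : x ∈ R := (Finset.mem_sdiff.1 hx).1
    have hfI : f' x ∈ I := Finset.mem_image_of_mem _ hx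
    have hfR : f' x ∈ R := hbsub (hIb hfI)
    rw [hv1 a v _ _ (Finset.mem_sdiff.1 hxR).2, hv _ hxR, hv _ hfR]
    apply f3 _ hxR _ hfR
    rw [gI _ hfI, gR _ hx]
    have : s (f' x) = x := i1 (hs1 _ hfI) hx (hs2 _ hfI)
    rw [this]

theorem s9extend {α : Type*} [Fintype α] [DecidableEq α] (R : Finset α) (f : α → α)
    (hf : Set.InjOn f R) (x y : α) (hxy : x ≠ y) (hx : x ∉ R) (hy : y ∉ R) :
    ∃ v : Equiv.Perm α, v ∈ alternatingGroup α ∧ ∀ z ∈ R, v z = f z := by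
  obtain ⟨σ, hσ⟩ : ∃ σ : Equiv.Perm α, ∀ z ∈ R, σ z = f z := by
    obtain ⟨g, hg⟩ := Finset.exists_equiv_extend_of_card_eq (t := Finset.univ) (s := R)
      (f := f) (by simp) (by simp) hf
    exact ⟨g.trans (Equiv.subtypeUnivEquiv (by simp)), fun z hz => by simpa using hg z hz⟩
  rcases Int.units_eq_one_or (Equiv.Perm.sign σ) with h | h
  · exact ⟨σ, by simpa [Equiv.Perm.mem_alternatingGroup] using h, hσ⟩
  · refine ⟨σ * Equiv.swap x y, ?_, ?_⟩
    · rw [Equiv.Perm.mem_alternatingGroup, Equiv.Perm.sign_mul, Equiv.Perm.sign_swap hxy, h]; rfl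
    · intro z hz
      have h1 : z ≠ x := fun h => hx (h ▸ hz)
      have h2 : z ≠ y := fun h => hy (h ▸ hz)
      rw [Equiv.Perm.mul_apply, Equiv.swap_apply_of_ne_of_ne h1 h2, hσ z hz]

theorem s9three {α : Type*} [Fintype α] [DecidableEq α] (d0 d1 d2 : α)
    (h01 : d0 ≠ d1) (h02 : d0 ≠ d2) (h12 : d1 ≠ d2) (v : Equiv.Perm α)
    (hv : s9Final d0 d1 d2 v) (a₀ : Equiv.Perm α)
    (ha : a₀ = Equiv.swap d0 d1 * Equiv.swap d1 d2) :
    ((v⁻¹ * a₀ * v)⁻¹ * a₀⁻¹ * (v⁻¹ * a₀ * v) * a₀).IsThreeCycle := by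
  obtain ⟨k1, ⟨k2, k3, k4⟩, k5, k6, k7⟩ := hv
  have e0 : v⁻¹ d1 = d0 := by rw [← k1]; simp
  obtain ⟨e1, he1⟩ : ∃ e1, v e1 = d0 := v.surjective d0
  obtain ⟨e2, he2⟩ : ∃ e2, v e2 = d2 := v.surjective d2
  have hw : v⁻¹ * a₀ * v = Equiv.swap e1 d0 * Equiv.swap d0 e2 := by
    have q1 : e1 = v⁻¹ d0 := by rw [← he1]; simp
    have q2 : e2 = v⁻¹ d2 := by rw [← he2]; simp
    have A := Equiv.swap_apply_apply v⁻¹ d0 d1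
    have B := Equiv.swap_apply_apply v⁻¹ d1 d2
    rw [e0, ← q1] at A
    rw [e0, ← q2] at B
    rw [A, B, ha]; group
  have n1 : e1 ≠ d0 := by rintro rfl; exact h01 (he1.symm.trans k1)
  have n2 : e1 ≠ d1 := by rintro rfl; exact k2 he1
  have n3 : e1 ≠ d2 := by rintro rfl; exact k5 he1
  have n4 : e2 ≠ d0 := by rintro rfl; exact h12 (k1.symm.trans he2)
  have n5 : e2 ≠ d1 := by rintro rfl; exact k4 he2
  have n6 : e2 ≠ d2 := by rintro rfl; exact k7 he2
  have n7 : e1 ≠ e2 := by rintro rfl; exact h02 (he1.symm.trans he2)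
  have : (v⁻¹ * a₀ * v)⁻¹ * a₀⁻¹ * (v⁻¹ * a₀ * v) * a₀
      = Equiv.swap e1 d0 * Equiv.swap e1 d2 := by
    rw [hw, ha]
    ext x
    simp only [mul_inv_rev, Equiv.swap_inv, Equiv.Perm.mul_apply]
    simp only [Equiv.swap_apply_def]
    grind
  rw [this]
  exact Equiv.Perm.isThreeCycle_swap_mul_swap_same n1 n3 h02

theorem s9build {α : Type*} [Fintype α] [DecidableEq α] : ∀ (ps : List ℕ) (T : Finset α),
    s9Chain ps T.card → ∃ d0 d1 d2 : α, d0 ≠ d1 ∧ d0 ≠ d2 ∧ d1 ≠ d2 ∧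
      d0 ∈ T ∧ d1 ∈ T ∧ d2 ∈ T ∧ ∃ L : List (Equiv.Perm α),
      L.map (fun a => a.support.card) = ps ∧ s9Good d0 d1 d2 L T ∧
      (∀ a ∈ L, a.IsCycle ∧ a.support ⊆ T ∧ d0 ∉ a.support ∧ d1 ∉ a.support ∧ d2 ∉ a.support) ∧
      L.Pairwise Equiv.Perm.Disjoint := by
  intro ps
  induction ps with
  | nil =>
    intro T hT
    obtain ⟨S, hS, hc⟩ := Finset.exists_subset_card_eq hT.1
    obtain ⟨d0, d1, d2, h1, h2, h3, rfl⟩ := Finset.card_eq_three.1 hc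
    have m0 : d0 ∈ T := hS (by simp)
    have m1 : d1 ∈ T := hS (by simp)
    have m2 : d2 ∈ T := hS (by simp)
    exact ⟨d0, d1, d2, h1, h2, h3, m0, m1, m2, [], rfl, ⟨m0, m1, m2, hT.2⟩, by simp, by simp⟩
  | cons p ps ih =>
    intro T hT
    obtain ⟨h5, hp, h2p, hC⟩ := hT
    obtain ⟨S, hS, hc⟩ := Finset.exists_subset_card_eq hp
    have hnd := S.nodup_toList
    have hlen : S.toList.length = p := by rw [Finset.length_toList, hc]
    have hcyc : S.toList.formPerm.IsCycle := List.isCycle_formPerm hnd (by omega)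
    have hsup : S.toList.formPerm.support = S := by
      rw [List.support_formPerm_of_nodup _ hnd, Finset.toList_toFinset]
      intro x hx
      have := congrArg List.length hx
      simp at this; omega
    generalize S.toList.formPerm = a at hcyc hsup
    subst hsup
    obtain ⟨d0, d1, d2, h1, h2, h3, m0, m1, m2, L, l1, l2, l3, l4⟩ := ih (T \ a.support)
      (by rwa [Finset.card_sdiff_of_subset hS, hc])
    rw [Finset.mem_sdiff] at m0 m1 m2
    refine ⟨d0, d1, d2, h1, h2, h3, m0.1, m1.1, m2.1, a :: L, ?_, ?_, ?_, ?_⟩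
    · simp [l1, hc]
    · refine ⟨hcyc, hS, ?_, by omega, l2⟩
      rw [Finset.card_sdiff_of_subset hS]; omega
    · intro b hb
      rcases List.mem_cons.1 hb with rfl | hb
      · exact ⟨hcyc, hS, m0.2, m1.2, m2.2⟩
      · obtain ⟨q1, q2, q3⟩ := l3 b hb
        exact ⟨q1, q2.trans Finset.sdiff_subset, q3⟩
    · rw [List.pairwise_cons]
      refine ⟨fun b hb => ?_, l4⟩
      rw [Equiv.Perm.disjoint_iff_disjoint_support, Finset.disjoint_right]
      intro x hx
      exact (Finset.mem_sdiff.1 ((l3 b hb).2.1 hx)).2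

theorem s9chain : ∀ (k n : ℕ) (p : Fin k → ℕ), (∀ i, 5 ≤ p i) →
    3 ≤ n - ∑ i, p i → n - ∑ i, p i ≤ 5 →
    (∀ i : Fin k, n < 2 * p i + ∑ j, if j < i then p j else 0) →
    s9Chain (List.ofFn p) n := by
  intro k
  induction k with
  | zero => intro n p _ h1 h2 _; simp at h1 h2; simp [s9Chain, h1, h2]
  | succ k ih =>
    intro n p h5 h1 h2 h
    rw [Fin.sum_univ_succ] at h1 h2
    rw [List.ofFn_succ]
    refine ⟨h5 0, by omega, ?_, ih _ _ (fun i => h5 _) (by omega) (by omega) ?_⟩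
    · have := h 0
      simp at this; omega
    · intro i
      have := h i.succ
      rw [Fin.sum_univ_succ] at this
      simp at this ⊢
      omega

theorem stmt9 (n k : ℕ) (hn : 7 ≤ n) (p : Fin k → ℕ)
    (hprime : ∀ i, (p i).Prime) (hp3 : ∀ i, 3 < p i) (hanti : StrictAnti p)
    (hsum : (n - ∑ i, p i) ∈ ({3, 4, 5} : Set ℕ))
    (hineq : ∀ i : Fin k, n < 2 * p i + ∑ j ∈ Finset.univ.filter (· < i), p j) :
    ∃ (y a₀ : Equiv.Perm (Fin n)) (a : Fin k → Equiv.Perm (Fin n)),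
      y ∈ alternatingGroup (Fin n) ∧
      a₀ ∈ alternatingGroup (Fin n) ∧ (∀ i, a i ∈ alternatingGroup (Fin n)) ∧
      a₀.IsCycle ∧ a₀.support.card = 3 ∧
      (∀ i, (a i).IsCycle ∧ (a i).support.card = p i) ∧
      (∀ i, a₀.Disjoint (a i)) ∧
      (∀ i j, i ≠ j → (a i).Disjoint (a j)) ∧
      ∃ v : Equiv.Perm (Fin n),
        v = (List.ofFn a).foldl (fun acc g => acc⁻¹ * g⁻¹ * acc * g) y ∧
        ((v⁻¹ * a₀ * v)⁻¹ * a₀⁻¹ * (v⁻¹ * a₀ * v) * a₀).IsThreeCycle := by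
  have hp5 : ∀ i, 5 ≤ p i := by
    intro i
    have h1 := hp3 i
    have h2 : p i ≠ 4 := by
      intro h; have := hprime i; rw [h] at this; revert this; norm_num
    omega
  simp only [Set.mem_insert_iff, Set.mem_singleton_iff] at hsum
  have hchain := s9chain k n p hp5 (by omega) (by omega)
    (fun i => by have := hineq i; rwa [Finset.sum_filter] at this)
  obtain ⟨d0, d1, d2, h1, h2, h3, -, -, -, L, l1, l2, l3, l4⟩ :=
    s9build (α := Fin n) (List.ofFn p) Finset.univ (by simpa using hchain)
  have hlen : L.length = k := by
    have := congrArg List.length l1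
    simpa using this
  subst hlen
  have hcard : ∀ i : Fin L.length, (L.get i).support.card = p i := by
    intro i
    have : (L.map (fun a => a.support.card))[i.1]'(by simp) = (List.ofFn p)[i.1]'(by simp) := by
      simp only [l1]
    simpa using this
  have hget : List.ofFn L.get = L := List.ofFn_get L
  obtain ⟨y, hy, hyf⟩ : ∃ y : Equiv.Perm (Fin n), y ∈ alternatingGroup (Fin n) ∧
      s9Final d0 d1 d2 (L.foldl s9comm y) := by
    cases L with
    | nil => simp at hsum; omega
    | cons a L =>
      obtain ⟨f, f1, f2, f3⟩ := s9key d0 d1 d2 h1 h2 h3 L a _ l2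
      have h5 : 5 ≤ a.support.card := l2.2.2.2.1
      obtain ⟨x, hx, z, hz, hxz⟩ := Finset.one_lt_card.1 (show 1 < a.support.card by omega)
      obtain ⟨v, hv, hvf⟩ := s9extend _ f f1 x z hxz (by simp_all) (by simp_all)
      exact ⟨v, hv, f3 v hvf⟩
  have hthree : (Equiv.swap d0 d1 * Equiv.swap d1 d2).IsThreeCycle := by
    rw [Equiv.swap_comm d0 d1]
    exact Equiv.Perm.isThreeCycle_swap_mul_swap_same h1.symm h3 h2
  refine ⟨y, Equiv.swap d0 d1 * Equiv.swap d1 d2, L.get, hy, ?_, ?_, hthree.isCycle,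
    hthree.card_support, ?_, ?_, ?_, L.foldl s9comm y, ?_, ?_⟩
  · exact hthree.sign
  · intro i
    have hc := (l3 _ (L.get_mem i)).1
    rw [Equiv.Perm.mem_alternatingGroup, hc.sign, hcard]
    have : Odd (p i) := (hprime i).odd_of_ne_two (by have := hp5 i; omega)
    rw [this.neg_one_pow]; simp
  · intro i
    exact ⟨(l3 _ (L.get_mem i)).1, hcard i⟩
  · intro i
    obtain ⟨-, -, q0, q1, q2⟩ := l3 _ (L.get_mem i)
    intro x
    by_cases hx : x = d0 ∨ x = d1 ∨ x = d2
    · right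
      rcases hx with rfl | rfl | rfl
      · simpa using q0
      · simpa using q1
      · simpa using q2
    · left
      push Not at hx
      rw [Equiv.Perm.mul_apply, Equiv.swap_apply_of_ne_of_ne hx.2.1 hx.2.2,
        Equiv.swap_apply_of_ne_of_ne hx.1 hx.2.1]
  · intro i j hij
    have := List.pairwise_iff_get.1 l4
    rcases lt_or_gt_of_ne hij with h | h
    · exact this i j h
    · exact (this j i h).symm
  · rw [hget]; rfl
  · exact s9three d0 d1 d2 h1 h2 h3 _ hyf _ rfl
end

section
/- Let n ≥ 7, set p_0 = 3, and let p_1 > p_2 > … > p_k > 3 be primes with n − (p_0 + p_1 + … + p_k) ∈ {0,1,2} and p_i > (n − (p_1 + … + p_{i−1}))/2 for each i = 1,…,k. If x ∈ Sym(n) has order divisible by p_i for every i = 0,1,…,k, then for each i the cycle decomposition of x contains exactly one cycle whose length is divisible by p_i, and that cycle has length exactly p_i. -/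
/-- The cycle decomposition of `x` contains exactly one cycle whose length is
divisible by `p`, and any such cycle has length exactly `p`. -/
def uniqueCycleOfLength {α : Type*} [Fintype α] [DecidableEq α]
    (x : Equiv.Perm α) (p : ℕ) : Prop :=
  (∃! c, c ∈ x.cycleFactorsFinset ∧ p ∣ c.support.card) ∧
  ∀ c ∈ x.cycleFactorsFinset, p ∣ c.support.card → c.support.card = p

theorem aux10 {n : ℕ} (x : Equiv.Perm (Fin n)) (p : ℕ) (hp : p.Prime) (hd : p ∣ orderOf x)
    (Q : Finset ℕ) (hQ : ∀ q ∈ Q, ∃ c ∈ x.cycleFactorsFinset, c.support.card = q)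
    (hnd : ∀ q ∈ Q, ¬ p ∣ q) (hlt : n < 2 * p + ∑ q ∈ Q, q) :
    uniqueCycleOfLength x p := by
  set F := x.cycleFactorsFinset with hF
  set T := F.filter (fun c => p ∣ c.support.card) with hT
  have htot : ∑ c ∈ F, c.support.card ≤ n := by
    have h1 : ∑ c ∈ F, c.support.card = x.support.card := by
      rw [← Equiv.Perm.sum_cycleType, Equiv.Perm.cycleType_def]; rfl
    rw [h1]
    simpa using Finset.card_le_univ x.support
  have hQle : ∑ q ∈ Q, q ≤ ∑ c ∈ F.filter (fun c => ¬ p ∣ c.support.card), c.support.card := by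
    have hsub : Q ⊆ (F.filter (fun c => ¬ p ∣ c.support.card)).image (fun c => c.support.card) := by
      intro q hq
      obtain ⟨c, hc, rfl⟩ := hQ q hq
      exact Finset.mem_image.2 ⟨c, Finset.mem_filter.2 ⟨hc, hnd _ hq⟩, rfl⟩
    refine (Finset.sum_le_sum_of_subset hsub).trans ?_
    exact Finset.sum_image_le_of_nonneg (f := fun q : ℕ => q)
      (fun _ _ => Nat.zero_le _)
  have hsplit := Finset.sum_filter_add_sum_filter_not F (fun c => p ∣ c.support.card)
    (fun c => c.support.card)
  have hTlt : ∑ c ∈ T, c.support.card < 2 * p := by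
    rw [← hT] at hsplit
    omega
  have hpos : ∀ c ∈ T, p ≤ c.support.card := by
    intro c hc
    obtain ⟨hc1, hc2⟩ := Finset.mem_filter.1 hc
    have := (Equiv.Perm.mem_cycleFactorsFinset_iff.1 hc1).1.two_le_card_support
    exact Nat.le_of_dvd (by omega) hc2
  have hone : ∀ c ∈ T, c.support.card = p := by
    intro c hc
    have h1 : c.support.card ≤ ∑ c ∈ T, c.support.card :=
      Finset.single_le_sum (f := fun c : Equiv.Perm (Fin n) => c.support.card)
        (fun _ _ => Nat.zero_le _) hc
    obtain ⟨m, hm⟩ := (Finset.mem_filter.1 hc).2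
    have h2 := hpos c hc
    have hp0 := hp.pos
    have : m < 2 := by
      by_contra h
      have : p * 2 ≤ p * m := Nat.mul_le_mul_left _ (by omega)
      omega
    interval_cases m <;> omega
  have hcard : T.card ≤ 1 := by
    have h1 : T.card * p ≤ ∑ c ∈ T, c.support.card := by
      simpa using Finset.card_nsmul_le_sum T _ p hpos
    by_contra h
    have : 2 * p ≤ T.card * p := Nat.mul_le_mul_right _ (by omega)
    omega
  have hne : ∃ c ∈ F, p ∣ c.support.card := by
    rw [← Equiv.Perm.lcm_cycleType] at hd
    have h2 : x.cycleType.lcm ∣ x.cycleType.prod :=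
      Multiset.lcm_dvd.2 fun b hb => Multiset.dvd_prod hb
    obtain ⟨a, ha, hpa⟩ := hp.prime.exists_mem_multiset_dvd (hd.trans h2)
    rw [Equiv.Perm.cycleType_def, Multiset.mem_map] at ha
    obtain ⟨c, hc, rfl⟩ := ha
    exact ⟨c, hc, hpa⟩
  obtain ⟨c, hc, hpc⟩ := hne
  refine ⟨⟨c, ⟨hc, hpc⟩, fun d hd' => ?_⟩, fun c hc hpc => hone c (Finset.mem_filter.2 ⟨hc, hpc⟩)⟩
  exact Finset.card_le_one.1 hcard d (Finset.mem_filter.2 hd') c (Finset.mem_filter.2 ⟨hc, hpc⟩)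

theorem stmt10 (n k : ℕ) (hn : 7 ≤ n) (p : Fin k → ℕ)
    (hprime : ∀ i, (p i).Prime) (hp3 : ∀ i, 3 < p i) (hanti : StrictAnti p)
    (hsum_le : 3 + ∑ i, p i ≤ n) (hsum_ge : n ≤ 3 + ∑ i, p i + 2)
    (hineq : ∀ i : Fin k, n < 2 * p i + ∑ j ∈ Finset.univ.filter (· < i), p j)
    (x : Equiv.Perm (Fin n))
    (h3 : 3 ∣ orderOf x) (hp : ∀ i, p i ∣ orderOf x) :
    uniqueCycleOfLength x 3 ∧ ∀ i, uniqueCycleOfLength x (p i) := by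
  have hex : ∀ q, uniqueCycleOfLength x q → ∃ c ∈ x.cycleFactorsFinset, c.support.card = q := by
    rintro q ⟨⟨c, ⟨hc, hq⟩, -⟩, h⟩
    exact ⟨c, hc, h c hc hq⟩
  have key : ∀ i, uniqueCycleOfLength x (p i) := by
    intro i
    induction i using WellFoundedLT.induction with
    | ind i ih =>
      refine aux10 x (p i) (hprime i) (hp i) ((Finset.univ.filter (· < i)).image p) ?_ ?_ ?_
      · intro q hq
        obtain ⟨j, hj, rfl⟩ := Finset.mem_image.1 hq
        exact hex _ (ih j (Finset.mem_filter.1 hj).2)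
      · intro q hq hd
        obtain ⟨j, hj, rfl⟩ := Finset.mem_image.1 hq
        have h1 := hanti (Finset.mem_filter.1 hj).2
        have h2 := (Nat.prime_dvd_prime_iff_eq (hprime i) (hprime j)).1 hd
        omega
      · rw [Finset.sum_image (fun a _ b _ h => hanti.injective h)]
        exact hineq i
  refine ⟨?_, key⟩
  refine aux10 x 3 Nat.prime_three h3 (Finset.univ.image p) ?_ ?_ ?_
  · intro q hq
    obtain ⟨j, hj, rfl⟩ := Finset.mem_image.1 hq
    exact hex _ (key j)
  · intro q hq hd
    obtain ⟨j, hj, rfl⟩ := Finset.mem_image.1 hq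
    have h2 := (Nat.prime_dvd_prime_iff_eq Nat.prime_three (hprime j)).1 hd
    have := hp3 j
    omega
  · rw [Finset.sum_image (fun a _ b _ h => hanti.injective h)]
    omega
end

section
/- Let x be an element of the alternating group Alt(7). If x^{140} ≠ 1 and x^{105} ≠ 1, then x^{140} is a 3-cycle and x^{105} is a product of two disjoint transpositions. (Here 140 = 4·5·7 and 105 = 3·5·7.) -/
theorem small_ms (m : Multiset ℕ) (h2 : ∀ a ∈ m, 2 ≤ a) (hs : m.sum ≤ 1) : m = 0 := by
  induction m using Multiset.induction_on with
  | empty => rfl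
  | cons a s _ =>
    have := h2 a (Multiset.mem_cons_self a s)
    simp at hs
    omega

theorem ct_eq (m : Multiset ℕ) (h2 : ∀ a ∈ m, 2 ≤ a) (hs : m.sum ≤ 7)
    (he : Even (m.sum + m.card)) (h140 : ¬ m.lcm ∣ 140) (h105 : ¬ m.lcm ∣ 105) :
    m = {3, 2, 2} := by
  rw [Multiset.lcm_dvd] at h140 h105
  push Not at h140 h105
  obtain ⟨a, ha, ha'⟩ := h140
  obtain ⟨b, hb, hb'⟩ := h105
  have ha7 : a ≤ 7 := (Multiset.le_sum_of_mem ha).trans hs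
  have ha2 := h2 a ha
  obtain ⟨m', rfl⟩ := Multiset.exists_cons_of_mem ha
  have h2' : ∀ c ∈ m', 2 ≤ c := fun c hc => h2 c (Multiset.mem_cons_of_mem hc)
  simp only [Multiset.sum_cons, Multiset.card_cons] at hs he
  have h36 : a = 3 ∨ a = 6 := by
    interval_cases a <;> first | omega | (exfalso; revert ha'; decide)
  rcases h36 with rfl | rfl
  · have hbm : b ∈ m' := by
      rcases Multiset.mem_cons.1 hb with rfl | h
      · exact absurd (by decide) hb'
      · exact h
    have hb2 := h2' b hbm
    obtain ⟨s, rfl⟩ := Multiset.exists_cons_of_mem hbm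
    have h2s : ∀ c ∈ s, 2 ≤ c := fun c hc => h2' c (Multiset.mem_cons_of_mem hc)
    simp only [Multiset.sum_cons, Multiset.card_cons] at hs he
    have hb4 : b ≤ 4 := by omega
    have : b = 2 ∨ b = 4 := by
      interval_cases b <;> first | omega | (exfalso; revert hb'; decide)
    rcases this with rfl | rfl
    · by_cases h0 : s = 0
      · subst h0
        exact absurd he (by decide)
      · obtain ⟨c, hc⟩ := Multiset.exists_mem_of_ne_zero h0
        obtain ⟨t, rfl⟩ := Multiset.exists_cons_of_mem hc
        have hc2 := h2s c hc
        simp only [Multiset.sum_cons] at hs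
        have ht := small_ms t (fun d hd => h2s d (Multiset.mem_cons_of_mem hd)) (by omega)
        have : c = 2 := by omega
        subst this ht
        rfl
    · have := small_ms s h2s (by omega)
      subst this
      exact absurd he (by decide)
  · have := small_ms m' h2' (by omega)
    subst this
    exact absurd he (by decide)

theorem stmt12 (x : alternatingGroup (Fin 7)) (h140 : x ^ 140 ≠ 1) (h105 : x ^ 105 ≠ 1) :
    ((x ^ 140 : alternatingGroup (Fin 7)) : Equiv.Perm (Fin 7)).IsThreeCycle ∧
    ∃ t₁ t₂ : Equiv.Perm (Fin 7), t₁.IsSwap ∧ t₂.IsSwap ∧ t₁.Disjoint t₂ ∧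
      ((x ^ 105 : alternatingGroup (Fin 7)) : Equiv.Perm (Fin 7)) = t₁ * t₂ := by
  obtain ⟨y, hy⟩ := x
  have hs : Equiv.Perm.sign y = 1 := Equiv.Perm.mem_alternatingGroup.1 hy
  have k140 : ¬ y.cycleType.lcm ∣ 140 := by
    rw [Equiv.Perm.lcm_cycleType, orderOf_dvd_iff_pow_eq_one]
    exact fun h => h140 (Subtype.ext h)
  have k105 : ¬ y.cycleType.lcm ∣ 105 := by
    rw [Equiv.Perm.lcm_cycleType, orderOf_dvd_iff_pow_eq_one]
    exact fun h => h105 (Subtype.ext h)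
  have he : Even (y.cycleType.sum + y.cycleType.card) := by
    rw [Equiv.Perm.sign_of_cycleType] at hs
    by_contra hc
    rw [Nat.not_even_iff_odd] at hc
    rw [hc.neg_one_pow] at hs
    exact absurd hs (by decide)
  have hsum : y.cycleType.sum ≤ 7 := by
    rw [Equiv.Perm.sum_cycleType]
    exact (Finset.card_le_univ _).trans (by simp)
  have hct := ct_eq _ (fun a ha => Equiv.Perm.two_le_of_mem_cycleType ha) hsum he k140 k105
  have d1 : Equiv.Perm.Disjoint (Equiv.swap (3 : Fin 7) 4) (Equiv.swap 5 6) := by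
    unfold Equiv.Perm.Disjoint; decide
  have d2 : Equiv.Perm.Disjoint (Equiv.swap (0 : Fin 7) 1 * Equiv.swap 0 2)
      (Equiv.swap 3 4 * Equiv.swap 5 6) := by
    unfold Equiv.Perm.Disjoint; decide
  have t3 : (Equiv.swap (0 : Fin 7) 1 * Equiv.swap 0 2).IsThreeCycle :=
    Equiv.Perm.isThreeCycle_swap_mul_swap_same (by decide) (by decide) (by decide)
  have s1 : (Equiv.swap (3 : Fin 7) 4).IsSwap := ⟨3, 4, by decide, rfl⟩
  have s2 : (Equiv.swap (5 : Fin 7) 6).IsSwap := ⟨5, 6, by decide, rfl⟩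
  have hc : ((Equiv.swap (0 : Fin 7) 1 * Equiv.swap 0 2) *
      (Equiv.swap 3 4 * Equiv.swap 5 6)).cycleType = {3, 2, 2} := by
    rw [d2.cycleType_mul, d1.cycleType_mul, t3.cycleType, s1.isCycle.cycleType,
      s2.isCycle.cycleType, Equiv.Perm.card_support_eq_two.2 s1,
      Equiv.Perm.card_support_eq_two.2 s2]
    rfl
  obtain ⟨g, hg⟩ := isConj_iff.1 (Equiv.Perm.isConj_iff_cycleType_eq.2 (hc.trans hct.symm))
  set u := Equiv.swap (0 : Fin 7) 1 * Equiv.swap 0 2 with hu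
  set v := Equiv.swap (3 : Fin 7) 4 * Equiv.swap 5 6 with hv
  have hu3 : u ^ 3 = 1 := by rw [hu]; decide
  have hv2 : v ^ 2 = 1 := by rw [hv]; decide
  have hcomm : Commute u v := d2.commute
  have e140 : y ^ 140 = g * u ^ 2 * g⁻¹ := by
    rw [← hg, conj_pow, hcomm.mul_pow, show 140 = 3 * 46 + 2 from rfl, pow_add u, pow_mul u, hu3,
      show 3 * 46 + 2 = 2 * 70 from rfl, pow_mul v, hv2]
    simp
  have e105 : y ^ 105 = g * v * g⁻¹ := by
    rw [← hg, conj_pow, hcomm.mul_pow, show 105 = 3 * 35 from rfl, pow_mul u, hu3,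
      show 3 * 35 = 2 * 52 + 1 from rfl, pow_add v, pow_mul v, hv2]
    simp
  refine ⟨?_, g * Equiv.swap 3 4 * g⁻¹, g * Equiv.swap 5 6 * g⁻¹, ?_, ?_, ?_, ?_⟩
  · change (y ^ 140).IsThreeCycle
    rw [e140, Equiv.Perm.IsThreeCycle, Equiv.Perm.cycleType_conj, pow_two]
    exact t3.isThreeCycle_sq
  · rw [← Equiv.Perm.card_support_eq_two, Equiv.Perm.card_support_conj]
    exact Equiv.Perm.card_support_eq_two.2 s1
  · rw [← Equiv.Perm.card_support_eq_two, Equiv.Perm.card_support_conj]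
    exact Equiv.Perm.card_support_eq_two.2 s2
  · exact d1.conj g
  · change y ^ 105 = _
    rw [e105, hv]
    group
end
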